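/- arXiv:2410.12455 — 9 statements merged into one kernel-verified Lean document; each statement's English description precedes it below -/
import Mathlib

section
/- Convergence of SGD with constant stepsize under the α-β-condition (Theorem 1): Suppose f satisfies the α-β-condition on ℝ^d with parameters α > β > 0, each f_i is L-smooth, and σ_int² is finite. Let SGD run with constant stepsize γ satisfying 0 < γ ≤ (α − β)/(2L). Then min_{0 ≤ k < K} E[f(x^k) − f*] ≤ dist(x^0,𝒮)²/(K·γ·(α − β)) + (2Lγ/(α − β))·σ_int² + (2β/(α − β))·σ_int². -/
open scoped RealInnerProductSpace BigOperators

lemma aux_grad {E : Type*} [NormedAddCommGroup E] [InnerProductSpace ℝ E] [CompleteSpace E]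
    (F : E → ℝ) (hF : Differentiable ℝ F) (hb : BddBelow (Set.range F)) (L : ℝ) (hL : 0 < L)
    (hs : ∀ x y, ‖gradient F x - gradient F y‖ ≤ L * ‖x - y‖) (x : E) :
    ‖gradient F x‖ ^ 2 ≤ 2 * L * (F x - ⨅ z, F z) := by
  set g := gradient F x with hg
  have hder : ∀ t : ℝ, HasDerivAt (fun t : ℝ => F (x - t • g) + t * ‖g‖ ^ 2 - L / 2 * t ^ 2 * ‖g‖ ^ 2)
      (-⟪gradient F (x - t • g), g⟫ + ‖g‖ ^ 2 - L * t * ‖g‖ ^ 2) t := by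
    intro t
    have h1 : HasDerivAt (fun t : ℝ => x - t • g) (-g) t := by
      simpa using ((hasDerivAt_id t).smul_const g).const_sub x
    have h2 := (hF (x - t • g)).hasGradientAt.hasFDerivAt.comp_hasDerivAt t h1
    have h3 : HasDerivAt (fun t : ℝ => F (x - t • g)) (-⟪gradient F (x - t • g), g⟫) t := by
      simpa [Function.comp_def, InnerProductSpace.toDual_apply_apply] using h2
    have h4 : HasDerivAt (fun t : ℝ => t * ‖g‖ ^ 2) (‖g‖ ^ 2) t := by
      simpa using (hasDerivAt_id t).mul_const (‖g‖ ^ 2)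
    have h5 : HasDerivAt (fun t : ℝ => L / 2 * t ^ 2 * ‖g‖ ^ 2) (L * t * ‖g‖ ^ 2) t := by
      have := (((hasDerivAt_pow 2 t).const_mul (L / 2)).mul_const (‖g‖ ^ 2))
      refine this.congr_deriv ?_
      push_cast; ring
    exact (h3.add h4).sub h5
  have hanti : AntitoneOn (fun t : ℝ => F (x - t • g) + t * ‖g‖ ^ 2 - L / 2 * t ^ 2 * ‖g‖ ^ 2)
      (Set.Ici 0) := by
    apply antitoneOn_of_deriv_nonpos (convex_Ici 0)
    · exact fun t _ => (hder t).continuousAt.continuousWithinAt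
    · exact fun t _ => (hder t).differentiableAt.differentiableWithinAt
    · intro t ht
      rw [interior_Ici] at ht
      have ht : 0 < t := ht
      rw [(hder t).deriv]
      have h1 : ⟪g - gradient F (x - t • g), g⟫ ≤ ‖g - gradient F (x - t • g)‖ * ‖g‖ :=
        real_inner_le_norm _ _
      have h2 := hs x (x - t • g)
      rw [inner_sub_left, real_inner_self_eq_norm_sq] at h1
      rw [← hg, sub_sub_cancel, norm_smul, Real.norm_of_nonneg ht.le] at h2
      have h3 := mul_le_mul_of_nonneg_right h2 (norm_nonneg g)
      nlinarith
  have h := hanti (a := 0) (b := 1 / L) (by simp) (by simp [hL.le]) (by positivity)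
  have hinf := ciInf_le hb (x - (1 / L) • g)
  simp only [zero_smul, sub_zero, zero_mul, add_zero] at h
  have e : L / 2 * (1 / L) ^ 2 = 1 / (2 * L) := by field_simp
  rw [e] at h
  have h6 : ‖g‖ ^ 2 / (2 * L) ≤ F x - ⨅ z, F z := by
    have e2 : 1 / L * ‖g‖ ^ 2 - 1 / (2 * L) * ‖g‖ ^ 2 = ‖g‖ ^ 2 / (2 * L) := by field_simp; ring
    norm_num at h e2 hinf
    linarith
  rw [div_le_iff₀ (by positivity)] at h6
  linarith

lemma aux_update {K n : ℕ} (k : Fin K) (G : (Fin K → Fin n) → ℝ) :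
    ∑ ω : Fin K → Fin n, ∑ i, G (Function.update ω k i) = n * ∑ ω, G ω := by
  have h : ∑ p : (Fin K → Fin n) × Fin n, G (Function.update p.1 k p.2)
      = ∑ p : (Fin K → Fin n) × Fin n, G p.1 := by
    refine Finset.sum_nbij' (fun p => (Function.update p.1 k p.2, p.1 k))
      (fun p => (Function.update p.1 k p.2, p.1 k)) ?_ ?_ ?_ ?_ ?_ <;> simp
  rw [Fintype.sum_prod_type, Fintype.sum_prod_type] at h
  rw [h]
  simp [Finset.mul_sum]

/-- Convergence of SGD with constant stepsize under the α-β-condition. -/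
theorem sgd_constant_stepsize_abc
    {d n : ℕ} (hn : 0 < n)
    (F : Fin n → EuclideanSpace ℝ (Fin d) → ℝ)
    (hdiff : ∀ i, Differentiable ℝ (F i))
    (hbdd : ∀ i, BddBelow (Set.range (F i)))
    (Fstar : Fin n → ℝ) (hFstar : ∀ i, Fstar i = ⨅ x, F i x)
    (f : EuclideanSpace ℝ (Fin d) → ℝ)
    (hf : f = fun x => (1 / (n : ℝ)) * ∑ i, F i x)
    (S : Set (EuclideanSpace ℝ (Fin d)))
    (hS : S = {x | ∀ y, f x ≤ f y}) (hSne : S.Nonempty)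
    (fstar : ℝ) (hfstar : fstar = ⨅ x, f x)
    (σint2 : ℝ) (hσ : σint2 = fstar - (1 / (n : ℝ)) * ∑ i, Fstar i)
    (α β L : ℝ) (hβ : 0 < β) (hαβ : β < α) (hL : 0 < L)
    (habc : ∀ x : EuclideanSpace ℝ (Fin d), ∃ xp ∈ S,
      dist x xp = Metric.infDist x S ∧
      ∀ i, α * (F i x - F i xp) - β * (F i x - Fstar i)
        ≤ ⟪gradient (F i) x, x - xp⟫)
    (hsmooth : ∀ i (x y : EuclideanSpace ℝ (Fin d)),
      ‖gradient (F i) x - gradient (F i) y‖ ≤ L * ‖x - y‖)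
    (γ : ℝ) (hγpos : 0 < γ) (hγ : γ ≤ (α - β) / (2 * L))
    (K : ℕ) (hK : 0 < K)
    (x0 : EuclideanSpace ℝ (Fin d))
    (x : (Fin K → Fin n) → ℕ → EuclideanSpace ℝ (Fin d))
    (hx0 : ∀ ω, x ω 0 = x0)
    (hstep : ∀ ω (k : Fin K),
      x ω ((k : ℕ) + 1) = x ω k - γ • gradient (F (ω k)) (x ω k)) :
    ∃ k < K,
      (1 / (n : ℝ) ^ K) * ∑ ω : Fin K → Fin n, (f (x ω k) - fstar)
        ≤ Metric.infDist x0 S ^ 2 / (K * γ * (α - β))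
          + 2 * L * γ / (α - β) * σint2
          + 2 * β / (α - β) * σint2 := by
  classical
  have hn' : (0 : ℝ) < n := by exact_mod_cast hn
  have hK' : (0 : ℝ) < K := by exact_mod_cast hK
  have hfx : ∀ z ∈ S, f z = fstar := by
    intro z hz
    rw [hS] at hz
    have hz : ∀ y, f z ≤ f y := hz
    rw [hfstar]
    exact le_antisymm (le_ciInf hz) (ciInf_le ⟨f z, by rintro _ ⟨y, rfl⟩; exact hz y⟩ z)
  have hmean : ∀ z, ∑ i, F i z = n * f z := by
    intro z; rw [hf]; field_simp
  have hmeanS : ∑ i, Fstar i = n * (fstar - σint2) := by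
    rw [hσ]; field_simp; ring
  have hge : ∀ z, fstar ≤ f z := by
    obtain ⟨w, hw⟩ := hSne
    intro z
    rw [← hfx w hw]
    rw [hS] at hw
    exact hw z
  have hLγ : L * γ ≤ (α - β) / 2 := by
    rw [le_div_iff₀ (by positivity)] at hγ
    linarith
  -- one step averaged
  have hone : ∀ z, ∑ i, Metric.infDist (z - γ • gradient (F i) z) S ^ 2
      ≤ n * (Metric.infDist z S ^ 2 - γ * (α - β) * (f z - fstar)
        + 2 * γ * (β + L * γ) * σint2) := by
    intro z
    obtain ⟨p, hpS, hpd, hp⟩ := habc z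
    have hi : ∀ i, Metric.infDist (z - γ • gradient (F i) z) S ^ 2
        ≤ Metric.infDist z S ^ 2 - 2 * γ * α * (F i z - F i p)
          + (2 * γ * β + 2 * L * γ ^ 2) * (F i z - Fstar i) := by
      intro i
      have h1 : Metric.infDist (z - γ • gradient (F i) z) S ^ 2
          ≤ ‖(z - p) - γ • gradient (F i) z‖ ^ 2 := by
        apply pow_le_pow_left₀ Metric.infDist_nonneg
        refine (Metric.infDist_le_dist_of_mem hpS).trans_eq ?_
        rw [dist_eq_norm]; congr 1; abel
      rw [norm_sub_sq_real, inner_smul_right, norm_smul, mul_pow, Real.norm_of_nonneg hγpos.le,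
        real_inner_comm, ← dist_eq_norm, hpd] at h1
      have h2 := aux_grad (F i) (hdiff i) (hbdd i) L hL (hsmooth i) z
      rw [← hFstar i] at h2
      have h3 := mul_le_mul_of_nonneg_left h2 (sq_nonneg γ)
      have h4 := mul_le_mul_of_nonneg_left (hp i) hγpos.le
      nlinarith
    refine (Finset.sum_le_sum fun i _ => hi i).trans ?_
    rw [Finset.sum_add_distrib, Finset.sum_sub_distrib, ← Finset.mul_sum, ← Finset.mul_sum,
      Finset.sum_sub_distrib, Finset.sum_sub_distrib, hmean, hmean, hmeanS, hfx p hpS]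
    simp only [Finset.sum_const, Finset.card_univ, Fintype.card_fin, nsmul_eq_mul]
    have h5 : 0 ≤ n * (γ * (f z - fstar)) * ((α - β) / 2 - L * γ) :=
      mul_nonneg (mul_nonneg hn'.le (mul_nonneg hγpos.le (sub_nonneg.2 (hge z))))
        (sub_nonneg.2 hLγ)
    nlinarith
  -- adaptedness
  have hadapt : ∀ (k : ℕ) (hk : k ≤ K) (ω ω' : Fin K → Fin n),
      (∀ j : Fin K, (j : ℕ) < k → ω j = ω' j) → x ω k = x ω' k := by
    intro k
    induction k with
    | zero => intro _ ω ω' _; rw [hx0, hx0]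
    | succ k ih =>
      intro hk ω ω' h
      have e := ih (by omega) ω ω' (fun j hj => h j (by omega))
      have a := hstep ω ⟨k, hk⟩
      have b := hstep ω' ⟨k, hk⟩
      simp only at a b
      rw [a, b, e, h ⟨k, hk⟩ (by simp)]
  have hrec : ∀ k < K, ∑ ω, Metric.infDist (x ω (k + 1)) S ^ 2
      ≤ ∑ ω, Metric.infDist (x ω k) S ^ 2 - γ * (α - β) * ∑ ω, (f (x ω k) - fstar)
        + (n : ℝ) ^ K * (2 * γ * (β + L * γ) * σint2) := by
    intro k hk
    have h1 := aux_update (⟨k, hk⟩ : Fin K)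
      (fun ω : Fin K → Fin n => Metric.infDist (x ω (k + 1)) S ^ 2)
    have h2 : ∀ (ω : Fin K → Fin n) (i : Fin n), x (Function.update ω ⟨k, hk⟩ i) (k + 1)
        = x ω k - γ • gradient (F i) (x ω k) := by
      intro ω i
      have a := hstep (Function.update ω ⟨k, hk⟩ i) ⟨k, hk⟩
      simp only [Function.update_self] at a
      rw [a, hadapt k hk.le (Function.update ω ⟨k, hk⟩ i) ω]
      intro j hj
      rw [Function.update_of_ne]
      rintro rfl
      simp at hj
    simp only [h2] at h1
    have h3 := Finset.sum_le_sum (s := Finset.univ)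
      fun (ω : Fin K → Fin n) _ => hone (x ω k)
    rw [h1, ← Finset.mul_sum] at h3
    have h4 := le_of_mul_le_mul_left h3 hn'
    rw [Finset.sum_add_distrib, Finset.sum_sub_distrib, ← Finset.mul_sum] at h4
    simpa using h4
  by_contra hcon
  push Not at hcon
  set B := Metric.infDist x0 S ^ 2 / (K * γ * (α - β))
          + 2 * L * γ / (α - β) * σint2
          + 2 * β / (α - β) * σint2 with hB
  have hab : 0 < α - β := sub_pos.2 hαβ
  have hN : (0 : ℝ) < (n : ℝ) ^ K := by positivity
  have hc : ∀ k < K, (n : ℝ) ^ K * B < ∑ ω, (f (x ω k) - fstar) := by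
    intro k hk
    have := hcon k hk
    rw [one_div, inv_mul_eq_div, lt_div_iff₀ hN] at this
    linarith
  have hBe : γ * (α - β) * B = Metric.infDist x0 S ^ 2 / K + 2 * γ * (β + L * γ) * σint2 := by
    rw [hB]; field_simp; ring
  have hlt : ∀ k < K, ∑ ω, Metric.infDist (x ω (k + 1)) S ^ 2
      < ∑ ω, Metric.infDist (x ω k) S ^ 2 - (n : ℝ) ^ K * (Metric.infDist x0 S ^ 2 / K) := by
    intro k hk
    have h1 := hrec k hk
    have h2 := mul_lt_mul_of_pos_left (hc k hk) (mul_pos hγpos hab)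
    have h3 : γ * (α - β) * ((n : ℝ) ^ K * B) = (n : ℝ) ^ K * (Metric.infDist x0 S ^ 2 / K)
        + (n : ℝ) ^ K * (2 * γ * (β + L * γ) * σint2) := by
      rw [← mul_add, ← hBe]; ring
    linarith
  have htel : ∀ k ≤ K, ∑ ω, Metric.infDist (x ω k) S ^ 2
      ≤ (n : ℝ) ^ K * Metric.infDist x0 S ^ 2
        - k * ((n : ℝ) ^ K * (Metric.infDist x0 S ^ 2 / K)) := by
    intro k
    induction k with
    | zero => intro _; simp [hx0]
    | succ k ih =>
      intro hk
      have a := ih (by omega)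
      have b := hlt k hk
      push_cast
      linarith
  obtain ⟨m, rfl⟩ : ∃ m, K = m + 1 := ⟨K - 1, by omega⟩
  have a := htel m (by omega)
  have b := hlt m (by omega)
  have c : 0 ≤ ∑ ω, Metric.infDist (x ω (m + 1)) S ^ 2 :=
    Finset.sum_nonneg fun ω _ => sq_nonneg _
  have e : (m : ℝ) * ((n : ℝ) ^ (m + 1) * (Metric.infDist x0 S ^ 2 / ((m + 1 : ℕ) : ℝ)))
      + (n : ℝ) ^ (m + 1) * (Metric.infDist x0 S ^ 2 / ((m + 1 : ℕ) : ℝ))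
      = (n : ℝ) ^ (m + 1) * Metric.infDist x0 S ^ 2 := by
    push_cast; field_simp
  linarith
end

section
/- Convergence of SGD with decreasing stepsize under the α-β-condition: Suppose f satisfies the α-β-condition on ℝ^d with parameters α > β > 0, each f_i is L-smooth, and σ_int² is finite. Let SGD run with stepsizes γ_k = γ_0/√(k+1) where 0 < γ_0 ≤ (α − β)/(2L). Then for every K ≥ 1, min_{0 ≤ k < K} E[f(x^k) − f*] ≤ 5·dist(x^0,𝒮)²/(4(α − β)γ_0√K) + (5γ_0·L·σ_int²/(α − β))·log(K+1)/√K + (2β/(α − β))·σ_int². -/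
open scoped RealInnerProductSpace BigOperators

lemma aux_grad_sq {d : ℕ} (g : EuclideanSpace ℝ (Fin d) → ℝ) (hd : Differentiable ℝ g)
    (L m : ℝ) (hL : 0 < L) (hm : ∀ y, m ≤ g y)
    (hs : ∀ x y, ‖gradient g x - gradient g y‖ ≤ L * ‖x - y‖) (x : EuclideanSpace ℝ (Fin d)) :
    ‖gradient g x‖ ^ 2 ≤ 2 * L * (g x - m) := by
  set v := gradient g x with hv
  have hder : ∀ t : ℝ, HasDerivAt
      (fun t : ℝ => g (x - t • v) + t * ‖v‖ ^ 2 - L / 2 * t ^ 2 * ‖v‖ ^ 2)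
      (-⟪gradient g (x - t • v), v⟫ + ‖v‖ ^ 2 - L * t * ‖v‖ ^ 2) t := by
    intro t
    have h1 : HasDerivAt (fun t : ℝ => x - t • v) (-v) t := by
      have := ((hasDerivAt_id t).smul_const v).const_sub x
      simpa using this
    have h2 := (hd (x - t • v)).hasGradientAt.hasFDerivAt.comp_hasDerivAt t h1
    have h3 : HasDerivAt (fun t : ℝ => g (x - t • v)) (-⟪gradient g (x - t • v), v⟫) t := by
      simpa [Function.comp_def] using h2
    have h4 : HasDerivAt (fun t : ℝ => t * ‖v‖ ^ 2) (‖v‖ ^ 2) t := by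
      simpa using (hasDerivAt_id t).mul_const (‖v‖ ^ 2)
    have h5 : HasDerivAt (fun t : ℝ => L / 2 * t ^ 2 * ‖v‖ ^ 2) (L * t * ‖v‖ ^ 2) t := by
      have := (((hasDerivAt_id t).pow 2).const_mul (L / 2)).mul_const (‖v‖ ^ 2)
      refine HasDerivAt.congr_deriv this ?_
      simp only [id]
      push_cast
      ring
    exact (h3.add h4).sub h5
  have hanti : AntitoneOn
      (fun t : ℝ => g (x - t • v) + t * ‖v‖ ^ 2 - L / 2 * t ^ 2 * ‖v‖ ^ 2) (Set.Ici 0) := by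
    apply antitoneOn_of_deriv_nonpos (convex_Ici 0)
    · exact fun t _ => (hder t).continuousAt.continuousWithinAt
    · exact fun t _ => (hder t).differentiableAt.differentiableWithinAt
    · intro t ht
      rw [interior_Ici] at ht
      have ht' : 0 < t := ht
      rw [(hder t).deriv]
      have h1 : ⟪v - gradient g (x - t • v), v⟫ ≤ L * t * ‖v‖ ^ 2 := by
        refine (real_inner_le_norm _ _).trans ?_
        have := hs x (x - t • v)
        rw [← hv, sub_sub_cancel, norm_smul, Real.norm_of_nonneg ht'.le] at this
        nlinarith [norm_nonneg v]
      rw [inner_sub_left, real_inner_self_eq_norm_sq] at h1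
      linarith
  have hLi : (0 : ℝ) ≤ 1 / L := by positivity
  have h := hanti (Set.mem_Ici.2 le_rfl) (Set.mem_Ici.2 hLi) hLi
  simp only [zero_smul, sub_zero] at h
  have h2 := hm (x - (1 / L) • v)
  have h3 : 1 / L * ‖v‖ ^ 2 - L / 2 * (1 / L) ^ 2 * ‖v‖ ^ 2 = ‖v‖ ^ 2 / (2 * L) := by
    field_simp; ring
  have h4 : ‖v‖ ^ 2 / (2 * L) ≤ g x - m := by nlinarith
  rw [div_le_iff₀ (by positivity)] at h4
  linarith

lemma aux_swap {K n : ℕ} (k : Fin K) (g : (Fin K → Fin n) → Fin n → ℝ)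
    (hg : ∀ ω j i, g (Function.update ω k j) i = g ω i) :
    (n : ℝ) * ∑ ω, g ω (ω k) = ∑ ω, ∑ i, g ω i := by
  have hinv : Function.Involutive (fun p : (Fin K → Fin n) × Fin n =>
      (Function.update p.1 k p.2, p.1 k)) := by
    rintro ⟨ω, i⟩
    simp
  have h := Equiv.sum_comp hinv.toPerm (fun p : (Fin K → Fin n) × Fin n => g p.1 p.2)
  rw [← Fintype.sum_prod_type', ← h, Fintype.sum_prod_type]
  simp [hg, Finset.mul_sum]

lemma aux_harm (K : ℕ) (hK : 1 ≤ K) :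
    2 * ∑ k ∈ Finset.range K, 1 / ((k : ℝ) + 1) ≤ 5 * Real.log (K + 1) := by
  have h1 := harmonic_le_one_add_log K
  have h2 : ((harmonic K : ℚ) : ℝ) = ∑ k ∈ Finset.range K, 1 / ((k : ℝ) + 1) := by
    simp [harmonic]
  rw [h2] at h1
  have hK' : (1 : ℝ) ≤ K := by exact_mod_cast hK
  have h3 : Real.log K ≤ Real.log (K + 1) := Real.log_le_log (by linarith) (by linarith)
  have h4 : Real.log 2 ≤ Real.log (K + 1) := Real.log_le_log (by norm_num) (by linarith)
  have := Real.log_two_gt_d9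
  linarith

lemma aux_sqrt (K : ℕ) :
    Real.sqrt K ≤ ∑ k ∈ Finset.range K, 1 / Real.sqrt ((k : ℝ) + 1) := by
  rcases Nat.eq_zero_or_pos K with h | hK
  · simp [h]
  have hK' : (0 : ℝ) < K := by exact_mod_cast hK
  have h : ∑ k ∈ Finset.range K, 1 / Real.sqrt (K : ℝ)
      ≤ ∑ k ∈ Finset.range K, 1 / Real.sqrt ((k : ℝ) + 1) := by
    apply Finset.sum_le_sum
    intro k hk
    have : (k : ℝ) + 1 ≤ K := by exact_mod_cast Finset.mem_range.1 hk
    apply one_div_le_one_div_of_le (Real.sqrt_pos.2 (by positivity)) (Real.sqrt_le_sqrt this)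
  refine le_trans (le_of_eq ?_) h
  simp only [Finset.sum_const, Finset.card_range, nsmul_eq_mul, mul_one_div, Real.div_sqrt]

/-- Convergence of SGD with decreasing stepsize `γ_k = γ₀/√(k+1)` under the α-β-condition. -/
theorem sgd_decreasing_stepsize_abc
    {d n : ℕ} (hn : 0 < n)
    (F : Fin n → EuclideanSpace ℝ (Fin d) → ℝ)
    (hdiff : ∀ i, Differentiable ℝ (F i))
    (hbdd : ∀ i, BddBelow (Set.range (F i)))
    (Fstar : Fin n → ℝ) (hFstar : ∀ i, Fstar i = ⨅ x, F i x)
    (f : EuclideanSpace ℝ (Fin d) → ℝ)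
    (hf : f = fun x => (1 / (n : ℝ)) * ∑ i, F i x)
    (S : Set (EuclideanSpace ℝ (Fin d)))
    (hS : S = {x | ∀ y, f x ≤ f y}) (hSne : S.Nonempty)
    (fstar : ℝ) (hfstar : fstar = ⨅ x, f x)
    (σint2 : ℝ) (hσ : σint2 = fstar - (1 / (n : ℝ)) * ∑ i, Fstar i)
    (α β L : ℝ) (hβ : 0 < β) (hαβ : β < α) (hL : 0 < L)
    (habc : ∀ x : EuclideanSpace ℝ (Fin d), ∃ xp ∈ S,
      dist x xp = Metric.infDist x S ∧
      ∀ i, α * (F i x - F i xp) - β * (F i x - Fstar i)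
        ≤ ⟪gradient (F i) x, x - xp⟫)
    (hsmooth : ∀ i (x y : EuclideanSpace ℝ (Fin d)),
      ‖gradient (F i) x - gradient (F i) y‖ ≤ L * ‖x - y‖)
    (γ0 : ℝ) (hγpos : 0 < γ0) (hγ : γ0 ≤ (α - β) / (2 * L))
    (K : ℕ) (hK : 1 ≤ K)
    (x0 : EuclideanSpace ℝ (Fin d))
    (x : (Fin K → Fin n) → ℕ → EuclideanSpace ℝ (Fin d))
    (hx0 : ∀ ω, x ω 0 = x0)
    (hstep : ∀ ω (k : Fin K),
      x ω ((k : ℕ) + 1)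
        = x ω k - (γ0 / Real.sqrt ((k : ℕ) + 1)) • gradient (F (ω k)) (x ω k)) :
    ∃ k < K,
      (1 / (n : ℝ) ^ K) * ∑ ω : Fin K → Fin n, (f (x ω k) - fstar)
        ≤ 5 * Metric.infDist x0 S ^ 2 / (4 * (α - β) * γ0 * Real.sqrt K)
          + (5 * γ0 * L * σint2 / (α - β)) * Real.log (K + 1) / Real.sqrt K
          + 2 * β / (α - β) * σint2 := by
  have hn' : (0 : ℝ) < n := by exact_mod_cast hn
  have hlow : ∀ i y, Fstar i ≤ F i y := fun i y => by
    rw [hFstar]; exact ciInf_le (hbdd i) y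
  have hSf : ∀ y ∈ S, f y = fstar := by
    intro y hy
    rw [hS] at hy
    rw [hfstar]
    exact le_antisymm (le_ciInf hy) (ciInf_le ⟨f y, by rintro _ ⟨z, rfl⟩; exact hy z⟩ y)
  have hfmin : ∀ y, fstar ≤ f y := by
    obtain ⟨s, hs⟩ := hSne
    intro y
    rw [← hSf s hs]
    rw [hS] at hs
    exact hs y
  have hsumF : ∀ y, ∑ i, F i y = n * f y := by
    intro y; rw [hf]; field_simp
  have hsumFs : ∑ i, Fstar i = n * (fstar - σint2) := by
    rw [hσ]; field_simp; ring
  have hσ0 : 0 ≤ σint2 := by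
    obtain ⟨s, hs⟩ := hSne
    have h1 : ∑ i, Fstar i ≤ ∑ i, F i s := Finset.sum_le_sum fun i _ => hlow i s
    rw [hsumF, hsumFs, hSf s hs] at h1
    nlinarith
  choose p hpS hpd hp using habc
  set γ : ℕ → ℝ := fun k => γ0 / Real.sqrt ((k : ℝ) + 1) with hγdef
  have hγp : ∀ k, 0 < γ k := fun k => by
    simp only [hγdef]; positivity
  have hγle : ∀ k, γ k ≤ γ0 := fun k => by
    apply div_le_self hγpos.le
    rw [Real.one_le_sqrt]; linarith [Nat.cast_nonneg (α := ℝ) k]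
  have hLγ : ∀ k, 2 * L * γ k ≤ α - β := fun k => by
    rw [le_div_iff₀ (by positivity)] at hγ
    nlinarith [hγle k]
  have hgrad := fun i y => aux_grad_sq (F i) (hdiff i) L (Fstar i) hL (hlow i) (hsmooth i) y
  -- adaptedness
  have hadapt : ∀ (k : Fin K) (ω : Fin K → Fin n) (j : Fin n) (m : ℕ), m ≤ k →
      x (Function.update ω k j) m = x ω m := by
    intro k ω j m
    induction m with
    | zero => intro _; rw [hx0, hx0]
    | succ m ih =>
      intro hm
      have hmk : m < k := hm
      have h1 := hstep (Function.update ω k j) ⟨m, hmk.trans k.2⟩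
      have h2 := hstep ω ⟨m, hmk.trans k.2⟩
      have hne : (⟨m, hmk.trans k.2⟩ : Fin K) ≠ k := by
        intro h; rw [← h] at hmk; simp at hmk
      rw [Function.update_of_ne hne] at h1
      simp only at h1 h2
      rw [h1, h2, ih hmk.le]
  set A : ℕ → ℝ := fun k => ∑ ω, Metric.infDist (x ω k) S ^ 2 with hA
  set Δ : ℕ → ℝ := fun k => ∑ ω : Fin K → Fin n, (f (x ω k) - fstar) with hΔ
  have hcard : (Finset.univ : Finset (Fin K → Fin n)).card = n ^ K := by simp
  have hΔ0 : ∀ k, 0 ≤ Δ k := fun k => Finset.sum_nonneg fun ω _ => sub_nonneg.2 (hfmin _)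
  have hrec : ∀ k < K, A (k + 1) ≤ A k - γ k * (α - β) * Δ k
      + (2 * γ k * β + 2 * L * γ k ^ 2) * σint2 * (n : ℝ) ^ K := by
    intro k hk
    set h : EuclideanSpace ℝ (Fin d) → Fin n → ℝ := fun y i =>
      -2 * γ k * (α * (F i y - F i (p y)) - β * (F i y - Fstar i))
        + γ k ^ 2 * (2 * L * (F i y - Fstar i)) with hh
    have h1 : ∀ ω, Metric.infDist (x ω (k + 1)) S ^ 2
        ≤ Metric.infDist (x ω k) S ^ 2 + h (x ω k) (ω ⟨k, hk⟩) := by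
      intro ω
      have e := hstep ω ⟨k, hk⟩
      simp only at e
      have e1 : Metric.infDist (x ω (k + 1)) S ≤ ‖x ω (k + 1) - p (x ω k)‖ := by
        rw [← dist_eq_norm]; exact Metric.infDist_le_dist_of_mem (hpS _)
      have e2 : Metric.infDist (x ω (k + 1)) S ^ 2 ≤ ‖x ω (k + 1) - p (x ω k)‖ ^ 2 :=
        pow_le_pow_left₀ Metric.infDist_nonneg e1 2
      have e3 : x ω (k + 1) - p (x ω k) = (x ω k - p (x ω k))
          - γ k • gradient (F (ω ⟨k, hk⟩)) (x ω k) := by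
        rw [e]; simp only [hγdef]; abel
      rw [e3, norm_sub_sq_real, real_inner_smul_right, norm_smul, mul_pow, Real.norm_eq_abs,
        sq_abs, real_inner_comm, ← dist_eq_norm, hpd] at e2
      have e4 := mul_le_mul_of_nonneg_left (hp (x ω k) (ω ⟨k, hk⟩)) (hγp k).le
      have e5 := mul_le_mul_of_nonneg_left (hgrad (ω ⟨k, hk⟩) (x ω k)) (sq_nonneg (γ k))
      simp only [hh]
      linarith
    have h2 : A (k + 1) ≤ A k + ∑ ω, h (x ω k) (ω ⟨k, hk⟩) := by
      simp only [hA]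
      rw [← Finset.sum_add_distrib]
      exact Finset.sum_le_sum fun ω _ => h1 ω
    have h3 := aux_swap (⟨k, hk⟩ : Fin K) (fun ω i => h (x ω k) i) (by
      intro ω j i
      rw [hadapt ⟨k, hk⟩ ω j k le_rfl])
    have h4 : ∀ y, ∑ i, h y i = n * ((-2 * γ k * α + 2 * γ k * β + 2 * L * γ k ^ 2) * (f y - fstar)
        + (2 * γ k * β + 2 * L * γ k ^ 2) * σint2) := by
      intro y
      simp only [hh, Finset.sum_add_distrib, ← Finset.mul_sum, Finset.sum_sub_distrib, hsumF,
        hsumFs, hSf _ (hpS y)]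
      ring
    simp only [h4, ← Finset.mul_sum] at h3
    have h5 := mul_left_cancel₀ hn'.ne' h3
    rw [h5, Finset.sum_add_distrib, ← Finset.mul_sum, Finset.sum_const, hcard, nsmul_eq_mul] at h2
    push_cast at h2
    have h6 : 0 ≤ γ k * ((α - β) - 2 * L * γ k) * Δ k :=
      mul_nonneg (mul_nonneg (hγp k).le (by linarith [hLγ k])) (hΔ0 k)
    simp only [hΔ] at h6 ⊢
    linarith
  have htel : ∀ m ≤ K, A m ≤ A 0 - ∑ k ∈ Finset.range m, γ k * (α - β) * Δ k
      + ∑ k ∈ Finset.range m, (2 * γ k * β + 2 * L * γ k ^ 2) * σint2 * (n : ℝ) ^ K := by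
    intro m
    induction m with
    | zero => simp
    | succ m ih =>
      intro hm
      rw [Finset.sum_range_succ, Finset.sum_range_succ]
      linarith [ih (by omega), hrec m hm]
  have hAK : 0 ≤ A K := Finset.sum_nonneg fun ω _ => sq_nonneg _
  have hA0 : A 0 = (n : ℝ) ^ K * Metric.infDist x0 S ^ 2 := by
    simp only [hA, hx0, Finset.sum_const, hcard, nsmul_eq_mul]; push_cast; ring
  have hfin := hAK.trans (htel K le_rfl)
  rw [hA0] at hfin
  have hN : (0 : ℝ) < (n : ℝ) ^ K := by positivity
  have hab : 0 < α - β := by linarith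
  have hKr : (0 : ℝ) < Real.sqrt K := Real.sqrt_pos.2 (by exact_mod_cast hK)
  set D := Metric.infDist x0 S ^ 2 with hD
  have hD0 : 0 ≤ D := sq_nonneg _
  by_contra hcon
  push Not at hcon
  set B := 5 * D / (4 * (α - β) * γ0 * Real.sqrt K)
          + (5 * γ0 * L * σint2 / (α - β)) * Real.log (K + 1) / Real.sqrt K
          + 2 * β / (α - β) * σint2 with hB
  have hlt : ∀ k < K, (n : ℝ) ^ K * B < Δ k := by
    intro k hk
    have := hcon k hk
    rw [one_div, ← div_eq_inv_mul, lt_div_iff₀ hN] at this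
    linarith
  set G := ∑ k ∈ Finset.range K, γ k with hG
  have hGe : γ0 * Real.sqrt K ≤ G := by
    have := mul_le_mul_of_nonneg_left (aux_sqrt K) hγpos.le
    rw [Finset.mul_sum] at this
    simpa only [hG, hγdef, mul_one_div] using this
  have hG2 : 2 * ∑ k ∈ Finset.range K, γ k ^ 2 ≤ γ0 ^ 2 * (5 * Real.log (K + 1)) := by
    have h1 := mul_le_mul_of_nonneg_left (aux_harm K hK) (sq_nonneg γ0)
    have h2 : ∑ k ∈ Finset.range K, γ k ^ 2
        = γ0 ^ 2 * ∑ k ∈ Finset.range K, 1 / ((k : ℝ) + 1) := by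
      rw [Finset.mul_sum]
      refine Finset.sum_congr rfl fun k _ => ?_
      simp only [hγdef]
      rw [div_pow, Real.sq_sqrt (by positivity), mul_one_div]
    rw [h2]; linarith
  have hsum : ∑ k ∈ Finset.range K, γ k * (α - β) * ((n : ℝ) ^ K * B)
      < ∑ k ∈ Finset.range K, γ k * (α - β) * Δ k := by
    apply Finset.sum_lt_sum_of_nonempty (Finset.nonempty_range_iff.2 (by omega))
    intro k hk
    exact mul_lt_mul_of_pos_left (hlt k (Finset.mem_range.1 hk)) (mul_pos (hγp k) hab)
  have hs1 : ∑ k ∈ Finset.range K, γ k * (α - β) * ((n : ℝ) ^ K * B)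
      = (n : ℝ) ^ K * (G * (α - β) * B) := by
    rw [← Finset.sum_mul, ← Finset.sum_mul]; ring
  have hs2 : ∑ k ∈ Finset.range K, (2 * γ k * β + 2 * L * γ k ^ 2) * σint2 * (n : ℝ) ^ K
      = (n : ℝ) ^ K * (2 * β * σint2 * G + L * σint2 * (2 * ∑ k ∈ Finset.range K, γ k ^ 2)) := by
    rw [← Finset.sum_mul, ← Finset.sum_mul, Finset.sum_add_distrib, ← Finset.mul_sum,
      ← Finset.sum_mul, ← Finset.mul_sum]
    ring
  rw [hs1] at hsum
  rw [hs2] at hfin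
  have hmain : G * (α - β) * B < D
      + (2 * β * σint2 * G + L * σint2 * (2 * ∑ k ∈ Finset.range K, γ k ^ 2)) := by
    apply lt_of_mul_lt_mul_left _ hN.le
    linarith
  have hlog : 0 ≤ Real.log ((K : ℝ) + 1) :=
    Real.log_nonneg (by linarith [Nat.cast_nonneg (α := ℝ) K])
  have hLσ := mul_le_mul_of_nonneg_left hG2 (mul_nonneg hL.le hσ0)
  set R := G / (γ0 * Real.sqrt K) with hR
  have hR1 : 1 ≤ R := by rw [hR, one_le_div (by positivity)]; exact hGe
  have hBe : G * (α - β) * B = R * (5 / 4 * D) + R * (L * σint2 * (γ0 ^ 2 * (5 * Real.log (K + 1))))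
      + 2 * β * σint2 * G := by
    rw [hB, hR]; field_simp
  have hq : 0 ≤ L * σint2 * (γ0 ^ 2 * (5 * Real.log (K + 1))) := by positivity
  nlinarith [mul_le_mul_of_nonneg_right hR1 hq, mul_le_mul_of_nonneg_right hR1 hD0]
end

section
/- Convergence of the Stochastic Polyak Stepsize SPS_max under the α-β-condition (Theorem 2): Suppose f satisfies the α-β-condition on ℝ^d with parameters α > β > 0, each f_i is L-smooth, σ_int² is finite, and along every index sequence and every iteration ∇f_{i_k}(x^k) ≠ 0. Run the iteration x^{k+1} = x^k − γ_k ∇f_{i_k}(x^k) with γ_k := min{ (f_{i_k}(x^k) − f_{i_k}*)/(c·‖∇f_{i_k}(x^k)‖²), γ_b }, where γ_b > 0 and c > 1/(2(α − β)). Then, with γ_min := min{1/(2cL), γ_b} and c_1 := c/(γ_min·(2(α − β)c − 1)), min_{0 ≤ k < K} E[f(x^k) − f*] ≤ (c_1/K)·dist(x^0,𝒮)² + 2α·c_1·γ_b·σ_int². -/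
open scoped RealInnerProductSpace BigOperators

lemma aux_descent {d : ℕ} (F : EuclideanSpace ℝ (Fin d) → ℝ) (hd : Differentiable ℝ F)
    (hb : BddBelow (Set.range F)) (L : ℝ) (hL : 0 < L)
    (hs : ∀ x y : EuclideanSpace ℝ (Fin d), ‖gradient F x - gradient F y‖ ≤ L * ‖x - y‖)
    (x : EuclideanSpace ℝ (Fin d)) :
    ‖gradient F x‖ ^ 2 / (2 * L) ≤ F x - ⨅ y, F y := by
  set g := gradient F x with hg
  have hder : ∀ t : ℝ, HasDerivAt (fun t : ℝ => F (x - t • g) + t * ‖g‖ ^ 2 - L * ‖g‖ ^ 2 / 2 * t ^ 2)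
      (-⟪gradient F (x - t • g), g⟫ + ‖g‖ ^ 2 - L * ‖g‖ ^ 2 * t) t := by
    intro t
    have h1 : HasDerivAt (fun t : ℝ => x - t • g) (-g) t := by
      have := ((hasDerivAt_id t).smul_const g).const_sub x
      simpa using this
    have h2 := ((hd (x - t • g)).hasGradientAt.hasFDerivAt).comp_hasDerivAt t h1
    have h3 := (h2.add ((hasDerivAt_id t).mul_const (‖g‖ ^ 2))).sub
      (((hasDerivAt_id t).pow 2).const_mul (L * ‖g‖ ^ 2 / 2))
    refine HasDerivAt.congr_deriv h3 ?_
    simp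
    ring
  have hanti : AntitoneOn (fun t : ℝ => F (x - t • g) + t * ‖g‖ ^ 2 - L * ‖g‖ ^ 2 / 2 * t ^ 2)
      (Set.Ici 0) := by
    apply antitoneOn_of_deriv_nonpos (convex_Ici 0)
    · exact fun t _ => (hder t).continuousAt.continuousWithinAt
    · exact fun t _ => (hder t).differentiableAt.differentiableWithinAt
    · intro t ht
      rw [interior_Ici] at ht
      have ht : 0 < t := ht
      rw [(hder t).deriv]
      have h1 := hs x (x - t • g)
      have h2 := real_inner_le_norm (gradient F x - gradient F (x - t • g)) g
      rw [inner_sub_left, ← hg, real_inner_self_eq_norm_sq] at h2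
      have h3 : ‖x - (x - t • g)‖ = t * ‖g‖ := by
        rw [sub_sub_cancel, norm_smul, Real.norm_of_nonneg ht.le]
      rw [h3, ← hg] at h1
      have h4 := mul_le_mul_of_nonneg_right h1 (norm_nonneg g)
      nlinarith
  have h := hanti (Set.mem_Ici.2 le_rfl) (Set.mem_Ici.2 (by positivity : (0:ℝ) ≤ 1 / L)) (by positivity)
  have h5 : ⨅ y, F y ≤ F (x - (1 / L) • g) := ciInf_le hb _
  simp only [zero_smul, sub_zero] at h
  have h6 : 1 / L * ‖g‖ ^ 2 - L * ‖g‖ ^ 2 / 2 * (1 / L) ^ 2 = ‖g‖ ^ 2 / (2 * L) := by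
    field_simp; ring
  nlinarith

lemma aux_avg {K n : ℕ} (k : Fin K) (G : (Fin K → Fin n) → Fin n → ℝ)
    (hG : ∀ ω j, G (Function.update ω k j) = G ω) :
    (n : ℝ) * ∑ ω, G ω (ω k) = ∑ ω, ∑ j, G ω j := by
  have hinv : Function.Involutive (fun p : (Fin K → Fin n) × Fin n =>
      (Function.update p.1 k p.2, p.1 k)) := by
    rintro ⟨ω, j⟩
    simp
  have h := Equiv.sum_comp hinv.toPerm (fun p => G p.1 (p.1 k))
  rw [Fintype.sum_prod_type, Fintype.sum_prod_type] at h
  simp [hG] at h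
  rw [h, Finset.mul_sum]

set_option maxHeartbeats 1000000 in
/-- Convergence of the Stochastic Polyak Stepsize SPS_max under the α-β-condition. -/
theorem sps_max_abc
    {d n : ℕ} (hn : 0 < n)
    (F : Fin n → EuclideanSpace ℝ (Fin d) → ℝ)
    (hdiff : ∀ i, Differentiable ℝ (F i))
    (hbdd : ∀ i, BddBelow (Set.range (F i)))
    (Fstar : Fin n → ℝ) (hFstar : ∀ i, Fstar i = ⨅ x, F i x)
    (f : EuclideanSpace ℝ (Fin d) → ℝ)
    (hf : f = fun x => (1 / (n : ℝ)) * ∑ i, F i x)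
    (S : Set (EuclideanSpace ℝ (Fin d)))
    (hS : S = {x | ∀ y, f x ≤ f y}) (hSne : S.Nonempty)
    (fstar : ℝ) (hfstar : fstar = ⨅ x, f x)
    (σint2 : ℝ) (hσ : σint2 = fstar - (1 / (n : ℝ)) * ∑ i, Fstar i)
    (α β L : ℝ) (hβ : 0 < β) (hαβ : β < α) (hL : 0 < L)
    (habc : ∀ x : EuclideanSpace ℝ (Fin d), ∃ xp ∈ S,
      dist x xp = Metric.infDist x S ∧
      ∀ i, α * (F i x - F i xp) - β * (F i x - Fstar i)
        ≤ ⟪gradient (F i) x, x - xp⟫)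
    (hsmooth : ∀ i (x y : EuclideanSpace ℝ (Fin d)),
      ‖gradient (F i) x - gradient (F i) y‖ ≤ L * ‖x - y‖)
    (c γb : ℝ) (hγb : 0 < γb) (hc : 1 / (2 * (α - β)) < c)
    (K : ℕ) (hK : 0 < K)
    (x0 : EuclideanSpace ℝ (Fin d))
    (x : (Fin K → Fin n) → ℕ → EuclideanSpace ℝ (Fin d))
    (hx0 : ∀ ω, x ω 0 = x0)
    (hgrad : ∀ ω (k : Fin K), gradient (F (ω k)) (x ω k) ≠ 0)
    (hstep : ∀ ω (k : Fin K),
      x ω ((k : ℕ) + 1)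
        = x ω k
          - (min ((F (ω k) (x ω k) - Fstar (ω k))
                / (c * ‖gradient (F (ω k)) (x ω k)‖ ^ 2)) γb)
            • gradient (F (ω k)) (x ω k))
    (γmin c1 : ℝ)
    (hγmin : γmin = min (1 / (2 * c * L)) γb)
    (hc1 : c1 = c / (γmin * (2 * (α - β) * c - 1))) :
    ∃ k < K,
      (1 / (n : ℝ) ^ K) * ∑ ω : Fin K → Fin n, (f (x ω k) - fstar)
        ≤ c1 / K * Metric.infDist x0 S ^ 2 + 2 * α * c1 * γb * σint2 := by
  have hα : 0 < α := hβ.trans hαβ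
  have hab : 0 < 2 * (α - β) := by linarith
  have hc0 : 0 < c := lt_trans (by positivity) hc
  have hq : 0 < 2 * (α - β) * c - 1 := by
    rw [div_lt_iff₀ hab] at hc; linarith
  have hγ0 : 0 < γmin := by rw [hγmin]; positivity
  have hc1p : 0 < c1 := by rw [hc1]; positivity
  have hn' : (0:ℝ) < n := by exact_mod_cast hn
  have hK' : (0:ℝ) < K := by exact_mod_cast hK
  have hfs : ∀ z ∈ S, f z = fstar := by
    intro z hz
    rw [hS] at hz
    rw [hfstar]
    exact le_antisymm (le_ciInf hz) (ciInf_le ⟨f z, by rintro _ ⟨y, rfl⟩; exact hz y⟩ z)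
  have hFs : ∀ i z, Fstar i ≤ F i z := fun i z => by
    rw [hFstar]; exact ciInf_le (hbdd i) z
  have hsum : ∀ z, ∑ i, (F i z - Fstar i) = n * (f z - fstar + σint2) := by
    intro z
    rw [Finset.sum_sub_distrib, hσ, hf]
    field_simp
    ring
  have hσ0 : 0 ≤ σint2 := by
    obtain ⟨z, hz⟩ := hSne
    have h1 := hsum z
    rw [hfs z hz] at h1
    have h2 : 0 ≤ ∑ i, (F i z - Fstar i) := Finset.sum_nonneg fun i _ => sub_nonneg.2 (hFs i z)
    rw [h1] at h2
    have := nonneg_of_mul_nonneg_right h2 hn'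
    linarith
  choose P hPS hPd hPi using habc
  -- one step
  have hone : ∀ ω (k : Fin K), Metric.infDist (x ω ((k:ℕ) + 1)) S ^ 2 ≤
      Metric.infDist (x ω k) S ^ 2 - (F (ω k) (x ω k) - Fstar (ω k)) / c1
        + 2 * α * γb * (F (ω k) (P (x ω k)) - Fstar (ω k)) := by
    intro ω k
    have hst := hstep ω k
    have hg0 := hgrad ω k
    set i := ω k
    set z := x ω k
    set g := gradient (F i) z with hg
    set Δ := F i z - Fstar i with hΔ
    set E := F i (P z) - Fstar i with hE
    have hΔ0 : 0 ≤ Δ := sub_nonneg.2 (hFs i z)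
    have hE0 : 0 ≤ E := sub_nonneg.2 (hFs i _)
    have hgn : 0 < ‖g‖ ^ 2 := by have := norm_pos_iff.2 hg0; positivity
    set γ := min (Δ / (c * ‖g‖ ^ 2)) γb with hγ
    have hγle : γ ≤ γb := min_le_right _ _
    have hγg : γ * ‖g‖ ^ 2 ≤ Δ / c := by
      have h1 : γ ≤ Δ / (c * ‖g‖ ^ 2) := min_le_left _ _
      rw [le_div_iff₀ (by positivity)] at h1 ⊢
      linarith
    have hγge : γmin ≤ γ := by
      rw [hγmin, hγ]
      apply min_le_min_right
      have h1 := aux_descent (F i) (hdiff i) (hbdd i) L hL (hsmooth i) z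
      rw [← hFstar, ← hg, ← hΔ, div_le_iff₀ (by positivity)] at h1
      rw [div_le_div_iff₀ (by positivity) (by positivity)]
      nlinarith
    have hγp : 0 < γ := hγ0.trans_le hγge
    have hin := hPi z i
    have hd1 : Metric.infDist (x ω ((k:ℕ) + 1)) S ≤ ‖(z - P z) - γ • g‖ := by
      have := Metric.infDist_le_dist_of_mem (x := x ω ((k:ℕ) + 1)) (hPS z)
      rw [hst, dist_eq_norm] at this
      rw [hst]
      have e : z - P z - γ • g = z - γ • g - P z := by abel
      rw [e]
      exact this
    have hd2 := pow_le_pow_left₀ Metric.infDist_nonneg hd1 2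
    rw [norm_sub_sq_real, ← dist_eq_norm, hPd, inner_smul_right, real_inner_comm, norm_smul,
      Real.norm_of_nonneg hγp.le] at hd2
    have e1 : (γ * ‖g‖) ^ 2 ≤ γ * (Δ / c) := by
      have := mul_le_mul_of_nonneg_left hγg hγp.le
      nlinarith
    have hin2 : (α - β) * Δ - α * E ≤ ⟪g, z - P z⟫ := by
      refine le_trans (le_of_eq ?_) hin
      rw [hΔ, hE]; ring
    have e2 := mul_le_mul_of_nonneg_left hin2 hγp.le
    have e3 : Δ / c1 = γmin * ((2 * (α - β) - 1 / c) * Δ) := by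
      rw [hc1]; field_simp
    have e4 : 0 ≤ (2 * (α - β) - 1 / c) * Δ := by
      apply mul_nonneg _ hΔ0
      rw [sub_nonneg, div_le_iff₀ hc0]; linarith
    have e5 := mul_le_mul_of_nonneg_right hγge e4
    have e6 : γ * ((2 * (α - β) - 1 / c) * Δ) = 2 * (γ * ((α - β) * Δ)) - γ * (Δ / c) := by
      ring
    have e7 : α * E * γ ≤ α * E * γb := mul_le_mul_of_nonneg_left hγle (by positivity)
    rw [e3]
    linarith
  -- adaptedness
  have hadapt : ∀ k : ℕ, k ≤ K → ∀ ω ω' : Fin K → Fin n,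
      (∀ j : Fin K, (j:ℕ) < k → ω j = ω' j) → x ω k = x ω' k := by
    intro k
    induction k with
    | zero => intro _ ω ω' _; rw [hx0, hx0]
    | succ k ih =>
      intro hk ω ω' h
      have h1 := ih (by omega) ω ω' (fun j hj => h j (by omega))
      have h2 := h ⟨k, by omega⟩ (by simp)
      have h3 := hstep ω ⟨k, by omega⟩
      have h4 := hstep ω' ⟨k, by omega⟩
      simp only at h3 h4
      rw [h3, h4, h2, h1]
  have hupd : ∀ (k : Fin K) ω j, x (Function.update ω k j) k = x ω k := by
    intro k ω j
    apply hadapt k k.2.le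
    intro l hl
    rw [Function.update_of_ne]
    rintro rfl
    exact lt_irrefl _ hl
  have hcard : ∑ _ω : Fin K → Fin n, (1:ℝ) = (n:ℝ) ^ K := by simp
  have hN : (0:ℝ) < (n:ℝ) ^ K := by positivity
  have hrec : ∀ k : Fin K, (∑ ω : Fin K → Fin n, (f (x ω k) - fstar)) ≤
      c1 * (∑ ω, Metric.infDist (x ω k) S ^ 2 - ∑ ω, Metric.infDist (x ω ((k:ℕ) + 1)) S ^ 2)
        + (n:ℝ) ^ K * (2 * α * c1 * γb * σint2) := by
    intro k
    have h1 := Finset.sum_le_sum (fun ω (_ : ω ∈ Finset.univ) => hone ω k)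
    rw [Finset.sum_add_distrib, Finset.sum_sub_distrib, ← Finset.sum_div, ← Finset.mul_sum] at h1
    have h2 := aux_avg k (fun ω i => F i (x ω k) - Fstar i) (by intro ω j; simp only [hupd])
    have h3 := aux_avg k (fun ω i => F i (P (x ω k)) - Fstar i) (by intro ω j; simp only [hupd])
    simp only [hsum, ← Finset.mul_sum] at h2 h3
    have h2 := mul_left_cancel₀ hn'.ne' h2
    have h3 := mul_left_cancel₀ hn'.ne' h3
    simp only [hfs _ (hPS _), sub_self, zero_add] at h3
    have h4 : ∑ _ω : Fin K → Fin n, σint2 = (n:ℝ) ^ K * σint2 := by simp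
    rw [Finset.sum_add_distrib, h4] at h2
    rw [h4] at h3
    rw [h2, h3] at h1
    set B := ∑ ω : Fin K → Fin n, (f (x ω k) - fstar)
    have h5 : B / c1 ≤ (B + (n:ℝ) ^ K * σint2) / c1 := by
      gcongr
      have : 0 ≤ (n:ℝ) ^ K * σint2 := by positivity
      linarith
    have h6 : B / c1 ≤ (∑ ω, Metric.infDist (x ω k) S ^ 2
        - ∑ ω, Metric.infDist (x ω ((k:ℕ) + 1)) S ^ 2)
        + 2 * α * γb * ((n:ℝ) ^ K * σint2) := by linarith
    rw [div_le_iff₀ hc1p] at h6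
    linarith
  by_contra hcon
  push Not at hcon
  have htel : ∀ m : ℕ, m ≤ K → m * ((n:ℝ) ^ K * (c1 / K * Metric.infDist x0 S ^ 2)) ≤
      c1 * ((n:ℝ) ^ K * Metric.infDist x0 S ^ 2 - ∑ ω, Metric.infDist (x ω m) S ^ 2)
      ∧ (0 < m → m * ((n:ℝ) ^ K * (c1 / K * Metric.infDist x0 S ^ 2)) <
      c1 * ((n:ℝ) ^ K * Metric.infDist x0 S ^ 2 - ∑ ω, Metric.infDist (x ω m) S ^ 2)) := by
    intro m
    induction m with
    | zero => intro _; simp [hx0]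
    | succ m ih =>
      intro hm
      have h1 := (ih (by omega)).1
      have h2 := hrec ⟨m, by omega⟩
      have h3 := hcon m (by omega)
      rw [one_div, inv_mul_eq_div, lt_div_iff₀ hN] at h3
      simp only at h2
      have : ((m + 1 : ℕ):ℝ) * ((n:ℝ) ^ K * (c1 / K * Metric.infDist x0 S ^ 2)) <
        c1 * ((n:ℝ) ^ K * Metric.infDist x0 S ^ 2 - ∑ ω, Metric.infDist (x ω (m+1)) S ^ 2) := by
        push_cast
        linarith
      exact ⟨this.le, fun _ => this⟩
  have hfin := (htel K le_rfl).2 hK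
  have h7 : (K:ℝ) * ((n:ℝ) ^ K * (c1 / K * Metric.infDist x0 S ^ 2))
      = c1 * ((n:ℝ) ^ K * Metric.infDist x0 S ^ 2) := by field_simp
  have h8 : 0 ≤ c1 * ∑ ω, Metric.infDist (x ω K) S ^ 2 := by positivity
  rw [h7] at hfin
  linarith
end

section
/- Convergence of NGN with constant stepsize parameter under the α-β-condition (Theorem 3): Suppose f satisfies the α-β-condition on ℝ^d with parameters α > β > 0 and α ≥ β + 1, each f_i is L-smooth and positive (f_i(x) > 0 for all x), σ_int² is finite, and σ_pos² := (1/n)∑_{i=1}^n f_i* is finite. Run x^{k+1} = x^k − γ_k ∇f_{i_k}(x^k) with the NGN stepsize γ_k := γ/(1 + (γ/(2 f_{i_k}(x^k)))·‖∇f_{i_k}(x^k)‖²), γ > 0. Then, with c_2 := 2γL(α − β − 1) + (α − β), min_{0 ≤ k ≤ K−1} E[f(x^k) − f*] ≤ dist(x^0,𝒮)²·(1 + 2γL)²/(2γK·c_2) + 3Lγα(1 + γL)·σ_int²/c_2 + (γL/c_2)·max{2γL − 1, 0}·σ_pos² + 2β·σ_int²/c_2. -/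
open scoped RealInnerProductSpace BigOperators

lemma ngn_grad_bound {E : Type*} [NormedAddCommGroup E] [InnerProductSpace ℝ E] [CompleteSpace E]
    (F : E → ℝ) (hd : Differentiable ℝ F) (L : ℝ) (hL : 0 < L)
    (hs : ∀ x y, ‖gradient F x - gradient F y‖ ≤ L * ‖x - y‖)
    (m : ℝ) (hm : ∀ x, m ≤ F x) (x : E) :
    ‖gradient F x‖ ^ 2 ≤ 2 * L * (F x - m) := by
  set g := gradient F x with hg
  have hderiv : ∀ s : ℝ, HasDerivAt (fun s : ℝ => F (x - s • g) + s * ‖g‖ ^ 2 - L * s ^ 2 * ‖g‖ ^ 2 / 2)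
      (-⟪gradient F (x - s • g), g⟫ + ‖g‖ ^ 2 - L * s * ‖g‖ ^ 2) s := by
    intro s
    have h1 : HasDerivAt (fun s : ℝ => x - s • g) (-g) s := by
      have := ((hasDerivAt_id s).smul_const g).const_sub x
      simpa using this
    have h2 := (hd (x - s • g)).hasGradientAt.hasFDerivAt.comp_hasDerivAt s h1
    have h3 : HasDerivAt (fun s : ℝ => s * ‖g‖ ^ 2) (‖g‖ ^ 2) s := by
      simpa using (hasDerivAt_id s).mul_const (‖g‖ ^ 2)
    have h4 : HasDerivAt (fun s : ℝ => L * s ^ 2 * ‖g‖ ^ 2 / 2) (L * s * ‖g‖ ^ 2) s := by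
      have := ((((hasDerivAt_id s).pow 2).const_mul L).mul_const (‖g‖ ^ 2)).div_const 2
      refine this.congr_deriv ?_
      simp
      ring
    have h5 := (h2.add h3).sub h4
    refine h5.congr_deriv ?_
    simp
  have hanti : AntitoneOn (fun s : ℝ => F (x - s • g) + s * ‖g‖ ^ 2 - L * s ^ 2 * ‖g‖ ^ 2 / 2)
      (Set.Ici 0) := by
    apply antitoneOn_of_deriv_nonpos (convex_Ici 0)
    · exact fun s _ => (hderiv s).continuousAt.continuousWithinAt
    · exact fun s _ => (hderiv s).differentiableAt.differentiableWithinAt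
    · intro s hsm
      rw [interior_Ici] at hsm
      have hs0 : 0 < s := hsm
      rw [(hderiv s).deriv]
      have h1 : ⟪g - gradient F (x - s • g), g⟫ ≤ L * s * ‖g‖ ^ 2 := by
        calc _ ≤ ‖g - gradient F (x - s • g)‖ * ‖g‖ := real_inner_le_norm _ _
          _ ≤ (L * ‖x - (x - s • g)‖) * ‖g‖ := by
            gcongr
            exact hs _ _
          _ = _ := by
            rw [sub_sub_cancel, norm_smul, Real.norm_of_nonneg hs0.le]
            ring
      rw [inner_sub_left, real_inner_self_eq_norm_sq] at h1
      linarith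
  have h := hanti (a := 0) (b := 1 / L) (by simp) (by simp [hL.le]) (by positivity)
  have h2 := hm (x - (1 / L) • g)
  simp only [zero_smul, sub_zero] at h
  have e1 : L * (1 / L) ^ 2 * ‖g‖ ^ 2 / 2 = ‖g‖ ^ 2 / L / 2 := by
    field_simp
  rw [e1] at h
  have e2 : 1 / L * ‖g‖ ^ 2 = ‖g‖ ^ 2 / L := by ring
  rw [e2] at h
  have h3 : ‖g‖ ^ 2 / L ≤ 2 * (F x - m) := by nlinarith
  rw [div_le_iff₀ hL] at h3
  linarith

lemma ngn_poly (t q : ℝ) (ht : 1 / 2 ≤ t) (hq : 0 ≤ q) (hqt : q ≤ t) :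
    0 ≤ (1 + q) ^ 2 * (t + q + 2 * t * q) + q * (1 + t) ^ 2 * (2 * t - 3 - 2 * q) := by
  obtain ⟨h, hh⟩ : ∃ h, h = t - 1 / 2 := ⟨_, rfl⟩
  have hte : t = 1 / 2 + h := by linarith
  have h0 : 0 ≤ h := by linarith
  have a0 : 0 ≤ 2 * (1 + q) * (q - 1 / 2) ^ 2 := by positivity
  have a1 : 0 ≤ h * (1 + 5 / 2 * q - q ^ 2 + 2 * q ^ 3) := by
    apply mul_nonneg h0
    nlinarith [mul_nonneg hq (sq_nonneg (q - 1 / 2))]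
  have a2 : 0 ≤ h ^ 2 * q * (4 - 2 * q + 2 * h) := by
    apply mul_nonneg (by positivity)
    linarith
  rw [hte]
  nlinarith

lemma ngn_step (t w F m M : ℝ) (ht : 0 < t) (hF : 0 < F) (hm : 0 ≤ m) (hmF : m ≤ F)
    (hM : M = max (2 * t - 1) 0)
    (hw0 : 1 ≤ w * (1 + t)) (hw1 : w ≤ 1) (hw : (1 - w) * F ≤ w * t * (F - m)) :
    w * (1 - w) * F * ((1 + t) * (1 + 2 * t)) ≤
      2 * t * (1 + t) * w * (F - m) + t * M * m := by
  have hwpos : 0 < w := by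
    by_contra h
    push Not at h
    nlinarith
  rcases le_or_gt (2 * t) 1 with h | h
  · have hM0 : M = 0 := by rw [hM]; exact max_eq_right (by linarith)
    rw [hM0]
    have h1 : w * (1 - w) * F ≤ w * (w * t * (F - m)) := by
      have := mul_le_mul_of_nonneg_left hw hwpos.le
      linarith
    have h2 : w * (1 + 2 * t) ≤ 2 := by nlinarith
    have h3 : 0 ≤ w * t * (F - m) * (1 + t) := by
      have : 0 ≤ F - m := by linarith
      positivity
    have h4 : 0 ≤ (1 + t) * (1 + 2 * t) := by positivity
    nlinarith [mul_le_mul_of_nonneg_right h1 h4, mul_le_mul_of_nonneg_left h2 h3]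
  · have hM0 : M = 2 * t - 1 := by rw [hM]; exact max_eq_left (by linarith)
    rw [hM0]
    obtain ⟨q, hq⟩ : ∃ q, q = w * (1 + t) - 1 := ⟨_, rfl⟩
    have hq0 : 0 ≤ q := by linarith
    have hqt : q ≤ t := by nlinarith
    have hqF : w * t * m ≤ q * F := by rw [hq]; linarith
    have hp := ngn_poly t q (by linarith) hq0 hqt
    -- goal: 0 ≤ X
    have hc : 0 ≤ w * (1 + t) * (w * (1 + 2 * t) - 1) := by
      have : 0 ≤ w * (1 + 2 * t) - 1 := by nlinarith
      positivity
    suffices hX : 0 ≤ w * (1 + t) * (w * (1 + 2 * t) - 1) * F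
        + (t * (2 * t - 1) - 2 * t * (1 + t) * w) * m by
      nlinarith
    rcases hq0.eq_or_lt with h0 | h0
    · have : m = 0 := by
        rw [← h0] at hqF
        have : 0 < w * t := by positivity
        nlinarith
      rw [this]
      have := mul_nonneg hc hF.le
      linarith
    · refine nonneg_of_mul_nonneg_right (a := q) ?_ h0
      have h5 := mul_le_mul_of_nonneg_left hqF hc
      have hwq : w = (1 + q) / (1 + t) := by
        rw [eq_div_iff (by positivity)]
        linarith
      have h6 : 0 ≤ (w * (1 + t) * (w * (1 + 2 * t) - 1)) * (w * t)
          + q * (t * (2 * t - 1) - 2 * t * (1 + t) * w) := by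
        have : (w * (1 + t) * (w * (1 + 2 * t) - 1)) * (w * t)
          + q * (t * (2 * t - 1) - 2 * t * (1 + t) * w) = t / (1 + t) ^ 2 * ((1 + q) ^ 2 * (t + q + 2 * t * q) + q * (1 + t) ^ 2 * (2 * t - 3 - 2 * q)) := by
          rw [hwq]
          field_simp
          ring
        rw [this]
        positivity
      nlinarith [mul_nonneg h6 hm]

lemma ngn_sum_update {K n : ℕ} (k : Fin K) (φ : (Fin K → Fin n) → ℝ) :
    ∑ ω : Fin K → Fin n, ∑ i : Fin n, φ (Function.update ω k i) = n * ∑ ω, φ ω := by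
  have hinv : Function.Involutive
      (fun p : (Fin K → Fin n) × Fin n => (Function.update p.1 k p.2, p.1 k)) := by
    rintro ⟨ω, i⟩
    simp
  have := Equiv.sum_comp hinv.toPerm (fun p : (Fin K → Fin n) × Fin n => φ p.1)
  rw [Fintype.sum_prod_type, Fintype.sum_prod_type] at this
  simp only [Function.Involutive.coe_toPerm] at this
  rw [this, Finset.mul_sum]
  simp

lemma ngn_sum_indep {K n : ℕ} {E : Type*} (k : Fin K) (h : Fin n → E → ℝ)
    (X : (Fin K → Fin n) → E) (hX : ∀ ω i, X (Function.update ω k i) = X ω) :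
    ∑ ω, ∑ i, h i (X ω) = n * ∑ ω, h (ω k) (X ω) := by
  rw [← ngn_sum_update k (fun ω => h (ω k) (X ω))]
  simp [hX]

/-- scalar one-step bound -/
lemma ngn_scalar (γ L α β t F Fp m G I M c2 η : ℝ) (hγ : 0 < γ) (hL : 0 < L) (hβ : 0 < β)
    (hα1 : β + 1 ≤ α) (ht : t = γ * L) (hF : 0 < F) (hm : 0 ≤ m) (hmF : m ≤ F) (hmp : m ≤ Fp)
    (hM : M = max (2 * t - 1) 0) (hG : 0 ≤ G) (hGb : G ≤ 2 * L * (F - m))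
    (hI : α * (F - Fp) - β * (F - m) ≤ I)
    (hc2 : c2 = 2 * t * (α - β - 1) + (α - β))
    (hη : η = γ / (1 + γ / (2 * F) * G)) :
    -2 * η * I + η ^ 2 * G ≤ 2 * γ / ((1 + t) * (1 + 2 * t)) *
      (- c2 * (F - m) + α * ((1 + t) * (1 + 2 * t)) * (Fp - m) + t * M * m) := by
  have ht0 : 0 < t := by rw [ht]; positivity
  obtain ⟨w, hw⟩ : ∃ w, w = 1 / (1 + γ / (2 * F) * G) := ⟨_, rfl⟩
  have hden : 0 < 1 + γ / (2 * F) * G := by positivity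
  have hw0 : 0 < w := by rw [hw]; positivity
  have hηw : η = γ * w := by rw [hη, hw]; ring
  have hweq : w * (2 * F + γ * G) = 2 * F := by
    rw [hw]; field_simp
  have h1 : (1 - w) * F = w * (γ * G / 2) := by linarith
  have h2 : γ * G / 2 ≤ t * (F - m) := by rw [ht]; nlinarith
  have h3 : (1 - w) * F ≤ w * t * (F - m) := by
    rw [h1, mul_assoc]; exact mul_le_mul_of_nonneg_left h2 hw0.le
  have hw1 : w ≤ 1 := by
    have : 0 ≤ (1 - w) * F := by rw [h1]; positivity
    nlinarith
  have hwt : 1 ≤ w * (1 + t) := by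
    have : 0 ≤ (w * (1 + t) - 1) * F := by nlinarith [mul_nonneg (mul_pos hw0 ht0).le hm]
    nlinarith
  have hs := ngn_step t w F m M ht0 hF hm hmF hM hwt hw1 h3
  have e1 : η ^ 2 * G = 2 * γ * (w * (1 - w) * F) := by
    have : η ^ 2 * G = 2 * γ * w * (w * (γ * G / 2)) := by rw [hηw]; ring
    rw [this, ← h1]; ring
  have hP : 0 < (1 + t) * (1 + 2 * t) := by positivity
  have hc2pos : 0 ≤ c2 := by
    rw [hc2]
    have : 0 ≤ α - β - 1 := by linarith
    have : 0 ≤ α - β := by linarith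
    positivity
  have e2 : -2 * η * I ≤ 2 * γ * (w * (-(α * (F - Fp) - β * (F - m)))) := by
    rw [hηw]
    have : 0 < γ * w := by positivity
    nlinarith
  have key : (w * (-(α * (F - Fp) - β * (F - m))) + w * (1 - w) * F) * ((1 + t) * (1 + 2 * t)) ≤
      - c2 * (F - m) + α * ((1 + t) * (1 + 2 * t)) * (Fp - m) + t * M * m := by
    have k1 : c2 * (F - m) ≤ w * (1 + t) * (c2 * (F - m)) := by
      have : 0 ≤ c2 * (F - m) := mul_nonneg hc2pos (by linarith)
      exact le_mul_of_one_le_left this hwt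
    have k2 : w * (α * ((1 + t) * (1 + 2 * t)) * (Fp - m)) ≤
        α * ((1 + t) * (1 + 2 * t)) * (Fp - m) := by
      have : 0 ≤ α * ((1 + t) * (1 + 2 * t)) * (Fp - m) :=
        mul_nonneg (mul_nonneg (by linarith) hP.le) (by linarith)
      exact mul_le_of_le_one_left this hw1
    have k3 : w * (-(α * (F - Fp) - β * (F - m))) * ((1 + t) * (1 + 2 * t))
        = - (w * (1 + t) * (c2 * (F - m))) + w * (α * ((1 + t) * (1 + 2 * t)) * (Fp - m))
          - 2 * t * (1 + t) * w * (F - m) := by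
      rw [hc2]; ring
    linarith
  calc -2 * η * I + η ^ 2 * G
      ≤ 2 * γ * (w * (-(α * (F - Fp) - β * (F - m))) + w * (1 - w) * F) := by
        rw [e1]; linarith
    _ ≤ 2 * γ * ((- c2 * (F - m) + α * ((1 + t) * (1 + 2 * t)) * (Fp - m) + t * M * m)
          / ((1 + t) * (1 + 2 * t))) := by
        apply mul_le_mul_of_nonneg_left _ (by positivity)
        rw [le_div_iff₀ hP]; exact key
    _ = _ := by ring

/-- Convergence of NGN with constant stepsize parameter under the α-β-condition. -/
theorem ngn_constant_abc
    {d n : ℕ} (hn : 0 < n)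
    (F : Fin n → EuclideanSpace ℝ (Fin d) → ℝ)
    (hdiff : ∀ i, Differentiable ℝ (F i))
    (hpos : ∀ i (x : EuclideanSpace ℝ (Fin d)), 0 < F i x)
    (hbdd : ∀ i, BddBelow (Set.range (F i)))
    (Fstar : Fin n → ℝ) (hFstar : ∀ i, Fstar i = ⨅ x, F i x)
    (f : EuclideanSpace ℝ (Fin d) → ℝ)
    (hf : f = fun x => (1 / (n : ℝ)) * ∑ i, F i x)
    (S : Set (EuclideanSpace ℝ (Fin d)))
    (hS : S = {x | ∀ y, f x ≤ f y}) (hSne : S.Nonempty)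
    (fstar : ℝ) (hfstar : fstar = ⨅ x, f x)
    (σint2 : ℝ) (hσ : σint2 = fstar - (1 / (n : ℝ)) * ∑ i, Fstar i)
    (σpos2 : ℝ) (hσpos : σpos2 = (1 / (n : ℝ)) * ∑ i, Fstar i)
    (α β L : ℝ) (hβ : 0 < β) (hαβ : β < α) (hα1 : β + 1 ≤ α) (hL : 0 < L)
    (habc : ∀ x : EuclideanSpace ℝ (Fin d), ∃ xp ∈ S,
      dist x xp = Metric.infDist x S ∧
      ∀ i, α * (F i x - F i xp) - β * (F i x - Fstar i)
        ≤ ⟪gradient (F i) x, x - xp⟫)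
    (hsmooth : ∀ i (x y : EuclideanSpace ℝ (Fin d)),
      ‖gradient (F i) x - gradient (F i) y‖ ≤ L * ‖x - y‖)
    (γ : ℝ) (hγ : 0 < γ)
    (K : ℕ) (hK : 0 < K)
    (x0 : EuclideanSpace ℝ (Fin d))
    (x : (Fin K → Fin n) → ℕ → EuclideanSpace ℝ (Fin d))
    (hx0 : ∀ ω, x ω 0 = x0)
    (hstep : ∀ ω (k : Fin K),
      x ω ((k : ℕ) + 1)
        = x ω k
          - (γ / (1 + γ / (2 * F (ω k) (x ω k)) * ‖gradient (F (ω k)) (x ω k)‖ ^ 2))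
            • gradient (F (ω k)) (x ω k))
    (c2 : ℝ) (hc2 : c2 = 2 * γ * L * (α - β - 1) + (α - β)) :
    ∃ k < K,
      (1 / (n : ℝ) ^ K) * ∑ ω : Fin K → Fin n, (f (x ω k) - fstar)
        ≤ Metric.infDist x0 S ^ 2 * (1 + 2 * γ * L) ^ 2 / (2 * γ * K * c2)
          + 3 * L * γ * α * (1 + γ * L) * σint2 / c2
          + γ * L / c2 * max (2 * γ * L - 1) 0 * σpos2
          + 2 * β * σint2 / c2 := by
  have hnR : (0 : ℝ) < n := by exact_mod_cast hn
  have hKR : (0 : ℝ) < K := by exact_mod_cast hK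
  obtain ⟨t, ht⟩ : ∃ t, t = γ * L := ⟨_, rfl⟩
  have ht0 : 0 < t := by rw [ht]; positivity
  obtain ⟨M, hM⟩ : ∃ M, M = max (2 * t - 1) 0 := ⟨_, rfl⟩
  have hM0 : 0 ≤ M := by rw [hM]; exact le_max_right _ _
  have hm0 : ∀ i, 0 ≤ Fstar i := fun i => by
    rw [hFstar]; exact le_ciInf fun y => (hpos i y).le
  have hmle : ∀ i y, Fstar i ≤ F i y := fun i y => by
    rw [hFstar]; exact ciInf_le (hbdd i) y
  have hmin : ∀ y ∈ S, f y = fstar := by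
    intro y hy
    rw [hS] at hy
    have hy' : ∀ z, f y ≤ f z := hy
    rw [hfstar]
    exact le_antisymm (le_ciInf hy') (ciInf_le ⟨f y, by rintro _ ⟨z, rfl⟩; exact hy' z⟩ y)
  obtain ⟨s, hsS⟩ := hSne
  have hfge : ∀ y, fstar ≤ f y := by
    intro y
    rw [← hmin s hsS]
    rw [hS] at hsS
    exact hsS y
  have hfe : ∀ y, ∑ i, F i y = n * f y := by
    intro y; rw [hf]; field_simp
  have hmsum : ∑ i, Fstar i = n * σpos2 := by rw [hσpos]; field_simp
  have hσ' : fstar = σint2 + σpos2 := by rw [hσ, hσpos]; ring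
  have hσ0 : 0 ≤ σint2 := by
    have h1 : ∑ i, Fstar i ≤ ∑ i, F i s := Finset.sum_le_sum fun i _ => hmle i s
    rw [hfe, hmin s hsS, hmsum, hσ'] at h1
    nlinarith
  have hσp0 : 0 ≤ σpos2 := by
    rw [hσpos]; exact mul_nonneg (by positivity) (Finset.sum_nonneg fun i _ => hm0 i)
  have hc2t : c2 = 2 * t * (α - β - 1) + (α - β) := by rw [hc2, ht]; ring
  have hc2pos : 0 < c2 := by
    rw [hc2t]
    have h1 : 0 ≤ α - β - 1 := by linarith
    have h2 : 0 < α - β := by linarith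
    positivity
  choose p hpS hpd hpi using habc
  obtain ⟨P, hP⟩ : ∃ P, P = (1 + t) * (1 + 2 * t) := ⟨_, rfl⟩
  have hPpos : 0 < P := by rw [hP]; positivity
  obtain ⟨C, hC⟩ : ∃ C, C = 2 * γ / P := ⟨_, rfl⟩
  have hCpos : 0 < C := by rw [hC]; positivity
  obtain ⟨h, hh⟩ : ∃ h : Fin n → EuclideanSpace ℝ (Fin d) → ℝ, h = fun i y =>
    C * (- c2 * (F i y - Fstar i) + α * P * (F i (p y) - Fstar i) + t * M * Fstar i) := ⟨_, rfl⟩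
  -- noise
  obtain ⟨N, hN⟩ : ∃ N, N = (3 * t * α * (1 + t) + 2 * β) * σint2 + t * M * σpos2 := ⟨_, rfl⟩
  have hsumh : ∀ y, ∑ i, h i y ≤ n * (C * (- c2 * (f y - fstar) + N)) := by
    intro y
    have e : ∑ i, h i y = n * (C * (- c2 * (f y - σpos2) + α * P * (f (p y) - σpos2) + t * M * σpos2)) := by
      rw [hh]
      simp only [← Finset.mul_sum, Finset.sum_add_distrib, Finset.sum_sub_distrib, hfe, hmsum]
      ring
    rw [e, hmin _ (hpS y)]
    apply mul_le_mul_of_nonneg_left _ hnR.le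
    apply mul_le_mul_of_nonneg_left _ hCpos.le
    rw [hN, hP]
    have hk : α * ((1 + t) * (1 + 2 * t)) - c2 ≤ 3 * t * α * (1 + t) + 2 * β := by
      rw [hc2t]; nlinarith [mul_nonneg ht0.le (sub_nonneg.2 hα1), mul_pos (mul_pos ht0 ht0) (hβ.trans hαβ)]
    have := mul_le_mul_of_nonneg_right hk hσ0
    rw [hσ']
    linarith
  have hstep' : ∀ ω (k : Fin K), Metric.infDist (x ω (k + 1)) S ^ 2 ≤
      Metric.infDist (x ω k) S ^ 2 + h (ω k) (x ω k) := by
    intro ω k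
    rw [hstep ω k]
    generalize x ω k = y
    generalize ω k = i
    obtain ⟨η, hη⟩ : ∃ η, η = γ / (1 + γ / (2 * F i y) * ‖gradient (F i) y‖ ^ 2) := ⟨_, rfl⟩
    rw [← hη]
    have h1 := ngn_scalar γ L α β t (F i y) (F i (p y)) (Fstar i) (‖gradient (F i) y‖ ^ 2)
      (⟪gradient (F i) y, y - p y⟫) M c2 η hγ hL hβ hα1 ht (hpos i y) (hm0 i) (hmle i y)
      (hmle i _) hM (by positivity)
      (ngn_grad_bound (F i) (hdiff i) L hL (hsmooth i) _ (hmle i) y) (hpi y i) hc2t hη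
    have h2 : Metric.infDist (y - η • gradient (F i) y) S ≤ dist (y - η • gradient (F i) y) (p y) :=
      Metric.infDist_le_dist_of_mem (hpS y)
    have h3 : dist (y - η • gradient (F i) y) (p y) ^ 2 = dist y (p y) ^ 2
        + (-2 * η * ⟪gradient (F i) y, y - p y⟫ + η ^ 2 * ‖gradient (F i) y‖ ^ 2) := by
      rw [dist_eq_norm, dist_eq_norm, sub_right_comm, norm_sub_sq_real, inner_smul_right,
        norm_smul, mul_pow, Real.norm_eq_abs, sq_abs, real_inner_comm]
      ring
    calc _ ≤ dist (y - η • gradient (F i) y) (p y) ^ 2 :=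
          pow_le_pow_left₀ Metric.infDist_nonneg h2 2
      _ ≤ _ := by
        rw [h3, hpd]
        simp only [hh, hC, hP]
        linarith
  have hind : ∀ k : ℕ, k ≤ K → ∀ ω ω' : Fin K → Fin n, (∀ j : Fin K, (j : ℕ) < k → ω j = ω' j) →
      x ω k = x ω' k := by
    intro k
    induction k with
    | zero => intro _ ω ω' _; rw [hx0, hx0]
    | succ k ih =>
      intro hk ω ω' hω
      have a1 := hstep ω ⟨k, hk⟩
      have a2 := hstep ω' ⟨k, hk⟩
      simp only at a1 a2
      rw [a1, a2, ih (by omega) ω ω' (fun j hj => hω j (by omega)), hω ⟨k, hk⟩ (by simp)]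
  obtain ⟨D, hD⟩ : ∃ D : ℕ → ℝ, D = fun k => ∑ ω, Metric.infDist (x ω k) S ^ 2 := ⟨_, rfl⟩
  obtain ⟨T, hT⟩ : ∃ T : ℝ, T = (n : ℝ) ^ K := ⟨_, rfl⟩
  have hTpos : 0 < T := by rw [hT]; positivity
  have hone : ∑ ω : Fin K → Fin n, (1 : ℝ) = T := by
    rw [hT]; simp
  have hDstep : ∀ k < K, D (k + 1) ≤ D k + C * (- c2 * ∑ ω, (f (x ω k) - fstar) + T * N) := by
    intro k hk
    have b1 : D (k + 1) ≤ D k + ∑ ω, h (ω ⟨k, hk⟩) (x ω k) := by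
      rw [hD]
      simp only
      rw [← Finset.sum_add_distrib]
      exact Finset.sum_le_sum fun ω _ => hstep' ω ⟨k, hk⟩
    have b2 := ngn_sum_indep ⟨k, hk⟩ h (fun ω => x ω k) (fun ω i => hind k hk.le _ _ (by
      intro j hj
      rw [Function.update_of_ne]
      intro hjk
      rw [hjk] at hj
      simp at hj))
    have b3 : ∑ ω, ∑ i, h i (x ω k) ≤ ∑ ω, n * (C * (- c2 * (f (x ω k) - fstar) + N)) :=
      Finset.sum_le_sum fun ω _ => hsumh _
    have b4 : ∑ ω, n * (C * (- c2 * (f (x ω k) - fstar) + N))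
        = n * (C * (- c2 * ∑ ω, (f (x ω k) - fstar) + T * N)) := by
      rw [← Finset.mul_sum, ← Finset.mul_sum, Finset.sum_add_distrib, ← Finset.mul_sum, ← hone,
        Finset.sum_mul]
      simp only [one_mul]
    rw [b4, b2] at b3
    have b5 := le_of_mul_le_mul_left b3 hnR
    linarith
  -- target
  obtain ⟨R, hR⟩ : ∃ R, R = Metric.infDist x0 S ^ 2 / (C * c2 * K) + N / c2 := ⟨_, rfl⟩
  have hex : ∃ k < K, ∑ ω, (f (x ω k) - fstar) ≤ T * R := by
    by_contra hcon
    push Not at hcon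
    have hall : ∀ k ≤ K, D k ≤ D 0 + k * (C * (- c2 * (T * R) + T * N)) := by
      intro k
      induction k with
      | zero => intro _; simp
      | succ k ih =>
        intro hk
        have c1 := hDstep k hk
        have c3 := ih (by omega)
        have c4 := mul_le_mul_of_nonneg_left (hcon k hk).le (mul_pos hCpos hc2pos).le
        push_cast
        linarith
    obtain ⟨K', rfl⟩ : ∃ K', K = K' + 1 := ⟨K - 1, by omega⟩
    have c1 := hDstep K' (by omega)
    have c3 := hall K' (by omega)
    have c4 := mul_lt_mul_of_pos_left (hcon K' (by omega)) (mul_pos hCpos hc2pos)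
    have c5 : D (K' + 1) < D 0 + ((K' + 1 : ℕ) : ℝ) * (C * (- c2 * (T * R) + T * N)) := by
      push_cast
      linarith
    have c6 : 0 ≤ D (K' + 1) := by
      rw [hD]; exact Finset.sum_nonneg fun _ _ => by positivity
    have c7 : D 0 = T * Metric.infDist x0 S ^ 2 := by
      rw [hD]
      simp only [hx0]
      rw [← hone, Finset.sum_mul]
      simp only [one_mul]
    have c8 : D 0 + ((K' + 1 : ℕ) : ℝ) * (C * (- c2 * (T * R) + T * N)) = 0 := by
      rw [c7, hR]
      field_simp
      ring
    linarith
  obtain ⟨k, hk, hle⟩ := hex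
  refine ⟨k, hk, ?_⟩
  have d1 : 1 / (n : ℝ) ^ K * ∑ ω, (f (x ω k) - fstar) ≤ R := by
    rw [← hT, one_div, inv_mul_le_iff₀ hTpos]
    exact hle
  refine d1.trans ?_
  have d2 : Metric.infDist x0 S ^ 2 / (C * c2 * K) ≤
      Metric.infDist x0 S ^ 2 * (1 + 2 * γ * L) ^ 2 / (2 * γ * K * c2) := by
    have e : Metric.infDist x0 S ^ 2 / (C * c2 * K) = Metric.infDist x0 S ^ 2 * P / (2 * γ * K * c2) := by
      rw [hC]; field_simp
    rw [e]
    have : P ≤ (1 + 2 * γ * L) ^ 2 := by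
      rw [mul_assoc 2 γ L, ← ht, hP]; nlinarith
    gcongr
  have d3 : N / c2 = 3 * L * γ * α * (1 + γ * L) * σint2 / c2
          + γ * L / c2 * max (2 * γ * L - 1) 0 * σpos2
          + 2 * β * σint2 / c2 := by
    rw [hN, hM, ht, mul_assoc 2 γ L]; ring
  rw [hR, d3]
  linarith
end

section
/- Convergence of AdaGrad-norm-max under the α-β-condition: Suppose f satisfies the α-β-condition on ℝ^d with parameters α > β > 0, each f_i is L-smooth, and σ_int² is finite. Assume ‖∇f_{i_k}(x^k)‖² ≤ G² for all iterations along every index sequence, and let D > 0 satisfy D² ≤ ‖∇f_i(x^0)‖² for every i ∈ {1,…,n}. Run the AdaGrad-norm-max iteration x^{k+1} = x^k − γ_k ∇f_{i_k}(x^k) with c_{−1} := 0, c_k² := max{c_{k−1}², ‖∇f_{i_k}(x^k)‖²}, b_k² := b_{k−1}² + c_k², γ_k := γ/b_k, where γ > 0 and b_{−1} ≥ 2Lγ/(α − β), b_{−1} > 0. Then min_{0 ≤ k < K} E[f(x^k) − f*] ≤ (dist(x^0,𝒮)²/(γK(α − β)))·√(b_{−1}² + G²K) + (4α/((α − β)K·D²))·σ_int²·√(b_{−1}²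 + G²K)·√(b_{−1}² + D²(K+1)). -/
open scoped RealInnerProductSpace BigOperators

lemma agn_descent {d : ℕ} (h : EuclideanSpace ℝ (Fin d) → ℝ) (hd : Differentiable ℝ h)
    (hb : BddBelow (Set.range h)) (L : ℝ) (hL : 0 < L)
    (hs : ∀ x y : EuclideanSpace ℝ (Fin d), ‖gradient h x - gradient h y‖ ≤ L * ‖x - y‖)
    (x : EuclideanSpace ℝ (Fin d)) :
    ‖gradient h x‖ ^ 2 ≤ 2 * L * (h x - ⨅ y, h y) := by
  set g := gradient h x with hg
  have hder : ∀ t : ℝ, HasDerivAt (fun t : ℝ => h (x - t • g) + t * ‖g‖ ^ 2 - L * t ^ 2 / 2 * ‖g‖ ^ 2)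
      (-⟪gradient h (x - t • g), g⟫ + ‖g‖ ^ 2 - L * t * ‖g‖ ^ 2) t := by
    intro t
    have h1 : HasDerivAt (fun t : ℝ => x - t • g) (-g) t := by
      simpa using ((hasDerivAt_id t).smul_const g).const_sub x
    have h2 := (hd (x - t • g)).hasGradientAt.hasFDerivAt.comp_hasDerivAt t h1
    have h3 : HasDerivAt (fun t : ℝ => t * ‖g‖ ^ 2) (‖g‖ ^ 2) t := by
      simpa using (hasDerivAt_id t).mul_const (‖g‖ ^ 2)
    have h4 : HasDerivAt (fun t : ℝ => L * t ^ 2 / 2 * ‖g‖ ^ 2) (L * t * ‖g‖ ^ 2) t := by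
      have := ((((hasDerivAt_id t).pow 2).const_mul L).div_const 2).mul_const (‖g‖ ^ 2)
      refine this.congr_deriv ?_
      simp only [id, Nat.cast_ofNat]
      ring
    have h5 := (h2.add h3).sub h4
    refine h5.congr_deriv ?_
    simp
  have hanti : AntitoneOn (fun t : ℝ => h (x - t • g) + t * ‖g‖ ^ 2 - L * t ^ 2 / 2 * ‖g‖ ^ 2)
      (Set.Ici 0) := by
    apply antitoneOn_of_deriv_nonpos (convex_Ici 0)
    · exact fun t _ => (hder t).continuousAt.continuousWithinAt
    · exact fun t _ => (hder t).differentiableAt.differentiableWithinAt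
    · intro t ht
      have ht : 0 < t := by simpa using ht
      rw [(hder t).deriv]
      have e1 : ⟪g - gradient h (x - t • g), g⟫ ≤ L * t * ‖g‖ ^ 2 := by
        calc ⟪g - gradient h (x - t • g), g⟫ ≤ ‖g - gradient h (x - t • g)‖ * ‖g‖ :=
              real_inner_le_norm _ _
          _ ≤ (L * ‖x - (x - t • g)‖) * ‖g‖ := by
              gcongr
              exact hs _ _
          _ = L * t * ‖g‖ ^ 2 := by
              rw [sub_sub_cancel, norm_smul, Real.norm_of_nonneg ht.le]; ring
      rw [inner_sub_left, real_inner_self_eq_norm_sq] at e1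
      linarith
  have hL' : (0:ℝ) ≤ 1 / L := by positivity
  have key := hanti (Set.mem_Ici.2 le_rfl) (Set.mem_Ici.2 hL') hL'
  have hlow : (⨅ y, h y) ≤ h (x - (1 / L) • g) := ciInf_le hb _
  simp only [zero_smul, sub_zero, zero_mul, add_zero] at key
  have e : 1 / L * ‖g‖ ^ 2 - L * (1 / L) ^ 2 / 2 * ‖g‖ ^ 2 = ‖g‖ ^ 2 / (2 * L) := by
    field_simp; ring
  have : ‖g‖ ^ 2 / (2 * L) ≤ h x - ⨅ y, h y := by
    rw [← e]; simp only [ne_eq, OfNat.ofNat_ne_zero, not_false_eq_true, zero_pow, mul_zero, zero_div, zero_mul, sub_zero] at key; linarith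
  rw [div_le_iff₀ (by positivity)] at this
  linarith

lemma agn_avg {K n : ℕ} (k : Fin K) (φ : (Fin K → Fin n) → Fin n → ℝ)
    (hφ : ∀ ω i j, φ (Function.update ω k i) j = φ ω j) :
    (n : ℝ) * ∑ ω : Fin K → Fin n, φ ω (ω k) = ∑ ω : Fin K → Fin n, ∑ i, φ ω i := by
  have h1 : ∑ p : (Fin K → Fin n) × Fin n, φ p.1 p.2
      = ∑ p : (Fin K → Fin n) × Fin n, φ p.1 (p.1 k) := by
    apply Finset.sum_nbij' (fun p => (Function.update p.1 k p.2, p.1 k))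
      (fun p => (Function.update p.1 k p.2, p.1 k))
    · simp
    · simp
    · simp
    · simp
    · intro p _
      simp [hφ]
  rw [Fintype.sum_prod_type, Fintype.sum_prod_type] at h1
  rw [h1, Finset.mul_sum]
  simp

lemma agn_sqrt_sum (b D : ℝ) (hb : 0 < b) (hD : 0 < D) (K : ℕ) :
    ∑ k ∈ Finset.range K, 1 / Real.sqrt (b ^ 2 + D ^ 2 * (k + 1))
      ≤ 2 / D ^ 2 * Real.sqrt (b ^ 2 + D ^ 2 * K) := by
  induction K with
  | zero => simp; positivity
  | succ K ih =>
    rw [Finset.sum_range_succ]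
    set p := Real.sqrt (b ^ 2 + D ^ 2 * K) with hp
    push_cast
    set q := Real.sqrt (b ^ 2 + D ^ 2 * (K + 1)) with hq
    have hp0 : 0 ≤ p := Real.sqrt_nonneg _
    have hq0 : 0 < q := Real.sqrt_pos.2 (by positivity)
    have hp2 : p ^ 2 = b ^ 2 + D ^ 2 * K := Real.sq_sqrt (by positivity)
    have hq2 : q ^ 2 = b ^ 2 + D ^ 2 * (K + 1) := Real.sq_sqrt (by positivity)
    have : 1 / q ≤ 2 / D ^ 2 * q - 2 / D ^ 2 * p := by
      have e : 2 / D ^ 2 * q - 2 / D ^ 2 * p = (2 * (q - p)) / D ^ 2 := by ring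
      rw [e, div_le_div_iff₀ hq0 (by positivity)]
      nlinarith [sq_nonneg (q - p)]
    linarith

set_option maxHeartbeats 1000000 in
/-- Convergence of AdaGrad-norm-max under the α-β-condition. Here `cs ω k` and `bs ω k`
represent the squares `c_k²` and `b_k²` tracked by the algorithm. -/
theorem adagrad_norm_max_abc
    {d n : ℕ} (hn : 0 < n)
    (F : Fin n → EuclideanSpace ℝ (Fin d) → ℝ)
    (hdiff : ∀ i, Differentiable ℝ (F i))
    (hbdd : ∀ i, BddBelow (Set.range (F i)))
    (Fstar : Fin n → ℝ) (hFstar : ∀ i, Fstar i = ⨅ x, F i x)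
    (f : EuclideanSpace ℝ (Fin d) → ℝ)
    (hf : f = fun x => (1 / (n : ℝ)) * ∑ i, F i x)
    (S : Set (EuclideanSpace ℝ (Fin d)))
    (hS : S = {x | ∀ y, f x ≤ f y}) (hSne : S.Nonempty)
    (fstar : ℝ) (hfstar : fstar = ⨅ x, f x)
    (σint2 : ℝ) (hσ : σint2 = fstar - (1 / (n : ℝ)) * ∑ i, Fstar i)
    (α β L : ℝ) (hβ : 0 < β) (hαβ : β < α) (hL : 0 < L)
    (habc : ∀ x : EuclideanSpace ℝ (Fin d), ∃ xp ∈ S,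
      dist x xp = Metric.infDist x S ∧
      ∀ i, α * (F i x - F i xp) - β * (F i x - Fstar i)
        ≤ ⟪gradient (F i) x, x - xp⟫)
    (hsmooth : ∀ i (x y : EuclideanSpace ℝ (Fin d)),
      ‖gradient (F i) x - gradient (F i) y‖ ≤ L * ‖x - y‖)
    (γ : ℝ) (hγ : 0 < γ)
    (bm1 : ℝ) (hbm1pos : 0 < bm1) (hbm1 : 2 * L * γ / (α - β) ≤ bm1)
    (K : ℕ) (hK : 0 < K)
    (x0 : EuclideanSpace ℝ (Fin d))
    (x : (Fin K → Fin n) → ℕ → EuclideanSpace ℝ (Fin d))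
    (cs bs : (Fin K → Fin n) → ℕ → ℝ)
    (hx0 : ∀ ω, x ω 0 = x0)
    (hcs : ∀ ω (k : Fin K),
      cs ω (k : ℕ)
        = max (if (k : ℕ) = 0 then 0 else cs ω ((k : ℕ) - 1))
            (‖gradient (F (ω k)) (x ω k)‖ ^ 2))
    (hbs : ∀ ω (k : Fin K),
      bs ω (k : ℕ)
        = (if (k : ℕ) = 0 then bm1 ^ 2 else bs ω ((k : ℕ) - 1)) + cs ω (k : ℕ))
    (hstep : ∀ ω (k : Fin K),
      x ω ((k : ℕ) + 1)
        = x ω k - (γ / Real.sqrt (bs ω (k : ℕ))) • gradient (F (ω k)) (x ω k))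
    (G : ℝ) (hG : ∀ ω (k : Fin K), ‖gradient (F (ω k)) (x ω k)‖ ^ 2 ≤ G ^ 2)
    (D : ℝ) (hDpos : 0 < D) (hD : ∀ i, D ^ 2 ≤ ‖gradient (F i) x0‖ ^ 2) :
    ∃ k < K,
      (1 / (n : ℝ) ^ K) * ∑ ω : Fin K → Fin n, (f (x ω k) - fstar)
        ≤ Metric.infDist x0 S ^ 2 / (γ * K * (α - β)) * Real.sqrt (bm1 ^ 2 + G ^ 2 * K)
          + 4 * α / ((α - β) * K * D ^ 2) * σint2
            * Real.sqrt (bm1 ^ 2 + G ^ 2 * K)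
            * Real.sqrt (bm1 ^ 2 + D ^ 2 * (K + 1)) := by
  have hn' : (0:ℝ) < n := by exact_mod_cast hn
  have hKpos : (0:ℝ) < K := by exact_mod_cast hK
  have hab : 0 < α - β := by linarith
  have hα : 0 < α := by linarith
  choose P hPS hPd hPi using habc
  have hFlow : ∀ i y, Fstar i ≤ F i y := fun i y => by
    rw [hFstar]; exact ciInf_le (hbdd i) y
  have hfS : ∀ y, f (P y) = fstar := by
    intro y
    have hm := hPS y
    rw [hS] at hm
    rw [hfstar]
    refine le_antisymm (le_ciInf hm) (ciInf_le ⟨f (P y), ?_⟩ _)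
    rintro _ ⟨z, rfl⟩
    exact hm z
  have hfge : ∀ y, fstar ≤ f y := by
    intro y
    have hm := hPS y
    rw [hS] at hm
    rw [← hfS y]; exact hm y
  have hσ0 : 0 ≤ σint2 := by
    rw [hσ, ← hfS x0, hf]
    have : ∑ i, Fstar i ≤ ∑ i, F i (P x0) := Finset.sum_le_sum fun i _ => hFlow i _
    have := mul_le_mul_of_nonneg_left this (by positivity : (0:ℝ) ≤ 1 / n)
    simpa using this
  -- bounds on c, b
  have hcb : ∀ ω (k : ℕ), k < K → D ^ 2 ≤ cs ω k ∧ cs ω k ≤ G ^ 2 ∧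
      bm1 ^ 2 + D ^ 2 * (k + 1) ≤ bs ω k ∧ bs ω k ≤ bm1 ^ 2 + G ^ 2 * (k + 1) := by
    intro ω k
    induction k with
    | zero =>
      intro hk
      have h1 := hcs ω ⟨0, hk⟩
      have h2 := hbs ω ⟨0, hk⟩
      have h3 := hG ω ⟨0, hk⟩
      have h4 := hD (ω ⟨0, hk⟩)
      simp only [if_true] at h1 h2 h3
      rw [max_eq_right (by positivity)] at h1
      have h5 := hx0 ω
      rw [h5] at h1 h3
      rw [← h1] at h3 h4
      refine ⟨h4, h3, ?_, ?_⟩ <;> · rw [h2]; push_cast; linarith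
    | succ k ih =>
      intro hk
      obtain ⟨i1, i2, i3, i4⟩ := ih (by omega)
      have h1 := hcs ω ⟨k + 1, hk⟩
      have h2 := hbs ω ⟨k + 1, hk⟩
      have h3 := hG ω ⟨k + 1, hk⟩
      simp only [Nat.add_sub_cancel, Nat.succ_ne_zero, if_false] at h1 h2 h3
      have j1 : D ^ 2 ≤ cs ω (k + 1) := by rw [h1]; exact i1.trans (le_max_left _ _)
      have j2 : cs ω (k + 1) ≤ G ^ 2 := by rw [h1]; exact max_le i2 h3
      refine ⟨j1, j2, ?_, ?_⟩ <;> · rw [h2]; push_cast; linarith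
  -- adaptedness
  have hadapt : ∀ (ω ω' : Fin K → Fin n) (k : ℕ), k ≤ K →
      (∀ j : Fin K, (j : ℕ) < k → ω j = ω' j) →
      x ω k = x ω' k ∧ (k ≠ 0 → cs ω (k - 1) = cs ω' (k - 1) ∧ bs ω (k - 1) = bs ω' (k - 1)) := by
    intro ω ω' k
    induction k with
    | zero => intro _ _; exact ⟨by rw [hx0, hx0], fun h => absurd rfl h⟩
    | succ k ih =>
      intro hk hag
      obtain ⟨ix, ic⟩ := ih (by omega) (fun j hj => hag j (by omega))
      have hω := hag ⟨k, hk⟩ (Nat.lt_succ_self k)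
      have hc : cs ω k = cs ω' k := by
        have h1 := hcs ω ⟨k, hk⟩
        have h2 := hcs ω' ⟨k, hk⟩
        simp only at h1 h2
        rw [h1, h2, hω, ix]
        by_cases h0 : k = 0
        · simp [h0]
        · simp only [h0, if_false, (ic h0).1]
      have hb : bs ω k = bs ω' k := by
        have h1 := hbs ω ⟨k, hk⟩
        have h2 := hbs ω' ⟨k, hk⟩
        simp only at h1 h2
        rw [h1, h2, hc]
        by_cases h0 : k = 0
        · simp [h0]
        · simp only [h0, if_false, (ic h0).2]
      refine ⟨?_, fun _ => ⟨hc, hb⟩⟩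
      have h1 := hstep ω ⟨k, hk⟩
      have h2 := hstep ω' ⟨k, hk⟩
      simp only at h1 h2
      rw [h1, h2, hω, ix, hb]
  set M := Real.sqrt (bm1 ^ 2 + G ^ 2 * K) with hM
  have hMpos : 0 < M := Real.sqrt_pos.2 (by positivity)
  let u : ℕ → ℝ := fun k => 1 / Real.sqrt (bm1 ^ 2 + D ^ 2 * (k + 1))
  -- one step
  have hone : ∀ ω (k : Fin K),
      γ / M * (α - β) * (F (ω k) (x ω k) - Fstar (ω k))
        - 2 * α * γ * u k * (F (ω k) (P (x ω k)) - Fstar (ω k))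
      ≤ Metric.infDist (x ω k) S ^ 2 - Metric.infDist (x ω (k + 1)) S ^ 2 := by
    intro ω k
    obtain ⟨-, -, hbl, hbu⟩ := hcb ω k k.2
    set X := x ω k with hX
    set i := ω k with hi
    set g := gradient (F i) X with hg
    set s := Real.sqrt (bs ω k) with hs
    have hs1 : bm1 ≤ s := by
      apply Real.le_sqrt_of_sq_le
      have : 0 ≤ D ^ 2 * ((k:ℕ) + 1 : ℝ) := by positivity
      linarith
    have hspos : 0 < s := by linarith
    have hsM : s ≤ M := by
      apply Real.sqrt_le_sqrt
      have : ((k:ℕ) + 1 : ℝ) ≤ K := by exact_mod_cast k.2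
      have := mul_le_mul_of_nonneg_left this (sq_nonneg G)
      linarith
    have hsu : 1 / s ≤ u k := by
      apply one_div_le_one_div_of_le (Real.sqrt_pos.2 (by positivity))
      exact Real.sqrt_le_sqrt hbl
    set t := γ / s with ht
    have htpos : 0 < t := by positivity
    have htM : γ / M ≤ t := by rw [ht]; gcongr
    have htu : t ≤ γ * u k := by
      rw [ht, div_eq_mul_one_div]; gcongr
    have htL : 2 * L * t ≤ α - β := by
      rw [div_le_iff₀ hab] at hbm1
      rw [ht, ← mul_div_assoc, div_le_iff₀ hspos]
      nlinarith
    have hstep' := hstep ω k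
    rw [← hX, ← hi, ← hg, ← hs, ← ht] at hstep'
    have hd1 : Metric.infDist (x ω (k + 1)) S ≤ ‖(X - P X) - t • g‖ := by
      refine (Metric.infDist_le_dist_of_mem (hPS X)).trans (le_of_eq ?_)
      rw [hstep', dist_eq_norm]
      congr 1
      abel
    have hd2 : Metric.infDist (x ω (k + 1)) S ^ 2 ≤ ‖(X - P X) - t • g‖ ^ 2 :=
      pow_le_pow_left₀ Metric.infDist_nonneg hd1 2
    have hd3 : Metric.infDist X S ^ 2 = ‖X - P X‖ ^ 2 := by rw [← hPd, dist_eq_norm]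
    rw [norm_sub_sq_real, inner_smul_right, norm_smul, Real.norm_of_nonneg htpos.le,
      real_inner_comm, mul_pow] at hd2
    have hin := hPi X i
    rw [← hg] at hin
    have hde := agn_descent (F i) (hdiff i) (hbdd i) L hL (hsmooth i) X
    rw [← hFstar, ← hg] at hde
    have a0 : 0 ≤ F i X - Fstar i := by linarith [hFlow i X]
    have p0 : 0 ≤ F i (P X) - Fstar i := by linarith [hFlow i (P X)]
    set a := F i X - Fstar i with ha
    set p := F i (P X) - Fstar i with hp
    have hap : F i X - F i (P X) = a - p := by rw [ha, hp]; ring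
    rw [hap] at hin
    have q1 : t * (α * (a - p) - β * a) ≤ t * ⟪g, X - P X⟫ :=
      mul_le_mul_of_nonneg_left hin htpos.le
    have q2 : t ^ 2 * ‖g‖ ^ 2 ≤ t ^ 2 * (2 * L * a) :=
      mul_le_mul_of_nonneg_left hde (by positivity)
    have q3 : (t * a) * (2 * L * t) ≤ (t * a) * (α - β) :=
      mul_le_mul_of_nonneg_left htL (by positivity)
    have q4 : γ / M * ((α - β) * a) ≤ t * ((α - β) * a) :=
      mul_le_mul_of_nonneg_right htM (by positivity)
    have q5 : t * (2 * α * p) ≤ γ * u k * (2 * α * p) :=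
      mul_le_mul_of_nonneg_right htu (by positivity)
    rw [hd3]
    linarith
  -- telescoping
  have htel : ∀ ω, ∑ k : Fin K, (γ / M * (α - β) * (F (ω k) (x ω k) - Fstar (ω k))
        - 2 * α * γ * u k * (F (ω k) (P (x ω k)) - Fstar (ω k))) ≤ Metric.infDist x0 S ^ 2 := by
    intro ω
    refine (Finset.sum_le_sum fun k _ => hone ω k).trans ?_
    rw [Fin.sum_univ_eq_sum_range
      (fun k => Metric.infDist (x ω k) S ^ 2 - Metric.infDist (x ω (k + 1)) S ^ 2) K,
      Finset.sum_range_sub' (fun k => Metric.infDist (x ω k) S ^ 2), hx0]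
    linarith [sq_nonneg (Metric.infDist (x ω K) S)]
  have hinv : ∀ (k : Fin K) (ω : Fin K → Fin n) (i : Fin n),
      x (Function.update ω k i) k = x ω k := by
    intro k ω i
    refine (hadapt _ _ k k.2.le fun j hj => ?_).1
    rw [Function.update_of_ne]
    rintro rfl
    exact lt_irrefl _ hj
  set N : ℝ := (n : ℝ) ^ K with hN
  have hNpos : 0 < N := by positivity
  have hcard : ∑ _ω : Fin K → Fin n, (1:ℝ) = N := by simp [hN]
  have hmean : ∀ y, ∑ i, (F i y - Fstar i) = n * (f y - fstar + σint2) := by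
    intro y
    rw [hσ, hf, Finset.sum_sub_distrib]
    field_simp
    ring
  let e : ℕ → ℝ := fun k => (1 / N) * ∑ ω : Fin K → Fin n, (f (x ω k) - fstar)
  have hE1 : ∀ k : Fin K, ∑ ω : Fin K → Fin n, (F (ω k) (x ω k) - Fstar (ω k))
      = N * (e k + σint2) := by
    intro k
    have h := agn_avg k (fun ω i => F i (x ω k) - Fstar i) (fun ω i j => by simp only [hinv])
    simp only [hmean] at h
    rw [← Finset.mul_sum] at h
    have h := mul_left_cancel₀ hn'.ne' h
    have h2 : ∑ _ω : Fin K → Fin n, σint2 = N * σint2 := by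
      rw [← hcard, Finset.sum_mul]; simp only [one_mul]
    rw [h, Finset.sum_add_distrib, mul_add, h2]
    simp only [e]
    rw [← mul_assoc, mul_one_div_cancel hNpos.ne', one_mul]
  have hE2 : ∀ k : Fin K, ∑ ω : Fin K → Fin n, (F (ω k) (P (x ω k)) - Fstar (ω k))
      = N * σint2 := by
    intro k
    have h := agn_avg k (fun ω i => F i (P (x ω k)) - Fstar i) (fun ω i j => by simp only [hinv])
    simp only [hmean] at h
    rw [← Finset.mul_sum] at h
    have h := mul_left_cancel₀ hn'.ne' h
    rw [h, ← hcard, Finset.sum_mul]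
    simp only [hfS, sub_self, zero_add, one_mul]
  have hsum : ∑ k : Fin K, (γ / M * (α - β) * (e k + σint2) - 2 * α * γ * u k * σint2)
      ≤ Metric.infDist x0 S ^ 2 := by
    have h := Finset.sum_le_sum fun ω (_ : ω ∈ (Finset.univ : Finset (Fin K → Fin n))) => htel ω
    rw [Finset.sum_comm] at h
    simp only [Finset.sum_sub_distrib, ← Finset.mul_sum, hE1, hE2] at h
    have h2 : ∑ _ω : Fin K → Fin n, Metric.infDist x0 S ^ 2 = N * Metric.infDist x0 S ^ 2 := by
      rw [← hcard, Finset.sum_mul]; simp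
    rw [h2] at h
    have h3 : ∑ k : Fin K, 2 * α * γ * u k * (N * σint2)
        = N * ∑ k : Fin K, 2 * α * γ * u k * σint2 := by
      rw [Finset.mul_sum]; exact Finset.sum_congr rfl fun k _ => by ring
    rw [h3] at h
    rw [Finset.sum_sub_distrib, ← Finset.mul_sum]
    refine le_of_mul_le_mul_left ?_ hNpos
    linarith
  have hu := agn_sqrt_sum bm1 D hbm1pos hDpos K
  set Q := Real.sqrt (bm1 ^ 2 + D ^ 2 * (K + 1)) with hQ
  have hu' : ∑ k ∈ Finset.range K, u k ≤ 2 / D ^ 2 * Q := by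
    refine hu.trans ?_
    have : Real.sqrt (bm1 ^ 2 + D ^ 2 * K) ≤ Q := by
      apply Real.sqrt_le_sqrt
      have := sq_nonneg D
      linarith
    gcongr
  rw [Fin.sum_univ_eq_sum_range
    (fun k => γ / M * (α - β) * (e k + σint2) - 2 * α * γ * u k * σint2) K,
    Finset.sum_sub_distrib, ← Finset.mul_sum, ← Finset.sum_mul, ← Finset.mul_sum,
    Finset.sum_add_distrib] at hsum
  have hKσ : 0 ≤ ∑ k ∈ Finset.range K, σint2 := Finset.sum_nonneg fun _ _ => hσ0
  set T := ∑ k ∈ Finset.range K, e k with hT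
  have hTb : γ / M * (α - β) * T ≤ Metric.infDist x0 S ^ 2 + 2 * α * γ * (2 / D ^ 2 * Q) * σint2 := by
    have c1 : 0 ≤ γ / M * (α - β) := by positivity
    have c2 := mul_nonneg c1 hKσ
    have c3 : 2 * α * γ * (∑ k ∈ Finset.range K, u k) * σint2
        ≤ 2 * α * γ * (2 / D ^ 2 * Q) * σint2 := by gcongr
    linarith
  set R := Metric.infDist x0 S ^ 2 / (γ * K * (α - β)) * M
          + 4 * α / ((α - β) * K * D ^ 2) * σint2 * M * Q with hR
  have hTR : T ≤ ∑ k ∈ Finset.range K, R := by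
    rw [Finset.sum_const, Finset.card_range, nsmul_eq_mul]
    refine le_of_mul_le_mul_left (hTb.trans (le_of_eq ?_)) (by positivity : 0 < γ / M * (α - β))
    rw [hR]
    field_simp
    ring
  obtain ⟨k, hk, hke⟩ := Finset.exists_le_of_sum_le (Finset.nonempty_range_iff.2 hK.ne') hTR
  exact ⟨k, Finset.mem_range.1 hk, hke⟩
end

section
/- Example 1 (unbounded minimizer set): Let f_1(x,y) = (x+y)²/((x+y)²+1), f_2(x,y) = (x+y+1)²/((x+y+1)²+1), and f = (f_1 + f_2)/2 on ℝ². Then the set of global minimizers of f is the line 𝒮 = {(x,y) ∈ ℝ² : x + y = −1/2}, on which f_1 = f_2 = 1/5; inf f_1 = inf f_2 = 0; and for every α ≥ 5/2 and every β with 4α/5 ≤ β < α, for every (x,y) ∈ ℝ², the orthogonal projection (z,t) = ((x−y−1/2)/2, (−x+y−1/2)/2) of (x,y) onto 𝒮 satisfies, for i = 1, 2: ⟨∇f_i(x,y), (x−z, y−t)⟩ ≥ α(f_i(x,y) − f_i(z,t)) − β·f_i(x,y). In particular, f satisfies the α-β-condition on ℝ² with these parameters. -/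
open scoped RealInnerProductSpace BigOperators

theorem aux_val (s : ℝ) : (1/5 + 1/5 : ℝ)/2 ≤ (s^2/(s^2+1) + (s+1)^2/((s+1)^2+1))/2 := by
  have h1 : 0 < s^2+1 := by positivity
  have h2 : 0 < (s+1)^2+1 := by positivity
  rw [div_add_div _ _ h1.ne' h2.ne', div_le_div_iff_of_pos_right (by norm_num), le_div_iff₀ (by positivity)]
  nlinarith [sq_nonneg (s+1/2), sq_nonneg ((s+1/2)^2)]

theorem aux_eq (s : ℝ) (h : (s^2/(s^2+1) + (s+1)^2/((s+1)^2+1))/2 ≤ (1/5 + 1/5 : ℝ)/2) :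
    s = -(1/2) := by
  have h1 : 0 < s^2+1 := by positivity
  have h2 : 0 < (s+1)^2+1 := by positivity
  rw [div_add_div _ _ h1.ne' h2.ne', div_le_div_iff_of_pos_right (by norm_num), div_le_iff₀ (by positivity)] at h
  have : (s+1/2)^2 ≤ 0 := by nlinarith [sq_nonneg (s+1/2), sq_nonneg ((s+1/2)^2)]
  have : s+1/2 = 0 := by nlinarith [pow_eq_zero_iff (two_ne_zero) |>.1 (le_antisymm this (sq_nonneg (s+1/2)))]
  linarith

theorem aux_grad_s7 (c : ℝ) (p v : EuclideanSpace ℝ (Fin 2)) :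
    ⟪gradient (fun p : EuclideanSpace ℝ (Fin 2) => (p 0 + p 1 + c) ^ 2 / ((p 0 + p 1 + c) ^ 2 + 1)) p, v⟫
      = 2 * (p 0 + p 1 + c) / ((p 0 + p 1 + c)^2+1)^2 * (v 0 + v 1) := by
  have hd : ∀ s : ℝ, HasDerivAt (fun s : ℝ => s^2/(s^2+1)) (2*s/(s^2+1)^2) s := by
    intro s
    have h1 : s^2+1 ≠ 0 := by positivity
    have := ((hasDerivAt_pow 2 s).div ((hasDerivAt_pow 2 s).add_const 1) h1)
    refine this.congr_deriv ?_
    push_cast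
    field_simp
    ring
  have hl : HasFDerivAt (fun p : EuclideanSpace ℝ (Fin 2) => p 0 + p 1 + c)
      (PiLp.proj (𝕜 := ℝ) 2 (fun _ : Fin 2 => ℝ) 0 + PiLp.proj (𝕜 := ℝ) 2 (fun _ : Fin 2 => ℝ) 1) p :=
    (((PiLp.proj (𝕜 := ℝ) 2 (fun _ : Fin 2 => ℝ) 0).hasFDerivAt).add
      ((PiLp.proj (𝕜 := ℝ) 2 (fun _ : Fin 2 => ℝ) 1).hasFDerivAt)).add_const c
  have := (hd (p 0 + p 1 + c)).comp_hasFDerivAt p hl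
  have h2 := this.fderiv
  simp only [Function.comp_def] at h2
  rw [gradient, InnerProductSpace.toDual_symm_apply, h2]
  simp [mul_add]

theorem aux_ineq (u e α β : ℝ) (he : e^2 = 1/4) (hα : 5/2 ≤ α) (h1 : 4*α/5 ≤ β) :
    α * (u^2/(u^2+1) - 1/5) - β * (u^2/(u^2+1)) ≤ 2*u/(u^2+1)^2 * (u+e) := by
  have hp : 0 < u^2+1 := by positivity
  have ha : α * (u^2/(u^2+1) - 1/5) - β * (u^2/(u^2+1)) ≤ -(1/2)/(u^2+1) := by
    have e1 : α * (u^2/(u^2+1) - 1/5) - β * (u^2/(u^2+1)) = ((α-β)*u^2 - α/5*(u^2+1))/(u^2+1) := by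
      field_simp
      ring
    rw [e1, div_le_div_iff_of_pos_right hp]
    nlinarith [sq_nonneg u]
  have hb : -(1/2)/(u^2+1) ≤ 2*u/(u^2+1)^2 * (u+e) := by
    have e1 : -(1/2)/(u^2+1) = (-(1/2) * (u^2+1))/(u^2+1)^2 := by field_simp
    rw [e1, div_mul_eq_mul_div, div_le_div_iff_of_pos_right (by positivity)]
    nlinarith [sq_nonneg (u+e), sq_nonneg u]
  linarith

theorem aux_inf (c : ℝ) :
    (⨅ p : EuclideanSpace ℝ (Fin 2), (p 0 + p 1 + c) ^ 2 / ((p 0 + p 1 + c) ^ 2 + 1)) = 0 := by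
  have h0 : ∀ p : EuclideanSpace ℝ (Fin 2), 0 ≤ (p 0 + p 1 + c) ^ 2 / ((p 0 + p 1 + c) ^ 2 + 1) :=
    fun p => by positivity
  refine le_antisymm ?_ (le_ciInf h0)
  refine (ciInf_le ⟨0, by rintro _ ⟨p, rfl⟩; exact h0 p⟩ (!₂[-c, 0])).trans ?_
  simp

/-- Example 1: an unbounded minimizer set satisfying the α-β-condition. -/
theorem example_one_abc
    (f1 f2 f : EuclideanSpace ℝ (Fin 2) → ℝ)
    (hf1 : f1 = fun p => (p 0 + p 1) ^ 2 / ((p 0 + p 1) ^ 2 + 1))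
    (hf2 : f2 = fun p => (p 0 + p 1 + 1) ^ 2 / ((p 0 + p 1 + 1) ^ 2 + 1))
    (hf : f = fun p => (f1 p + f2 p) / 2)
    (S : Set (EuclideanSpace ℝ (Fin 2)))
    (hS : S = {p | ∀ q, f p ≤ f q}) :
    S = {p | p 0 + p 1 = -(1 / 2)} ∧
    (∀ p ∈ S, f1 p = 1 / 5 ∧ f2 p = 1 / 5) ∧
    (⨅ p, f1 p) = 0 ∧ (⨅ p, f2 p) = 0 ∧
    (∀ α β : ℝ, 5 / 2 ≤ α → 4 * α / 5 ≤ β → β < α →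
      ∀ p q : EuclideanSpace ℝ (Fin 2),
        q 0 = (p 0 - p 1 - 1 / 2) / 2 → q 1 = (-(p 0) + p 1 - 1 / 2) / 2 →
        (q ∈ S ∧ dist p q = Metric.infDist p S ∧
          α * (f1 p - f1 q) - β * f1 p ≤ ⟪gradient f1 p, p - q⟫ ∧
          α * (f2 p - f2 q) - β * f2 p ≤ ⟪gradient f2 p, p - q⟫)) := by
  have hf1' : f1 = fun p => (p 0 + p 1 + 0) ^ 2 / ((p 0 + p 1 + 0) ^ 2 + 1) := by
    simp only [hf1, add_zero]
  have v1 : ∀ p : EuclideanSpace ℝ (Fin 2), p 0 + p 1 = -(1/2) → f1 p = 1/5 := by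
    intro p h; simp only [hf1, h]; norm_num
  have v2 : ∀ p : EuclideanSpace ℝ (Fin 2), p 0 + p 1 = -(1/2) → f2 p = 1/5 := by
    intro p h; simp only [hf2, h]; norm_num
  have hSe : S = {p | p 0 + p 1 = -(1 / 2)} := by
    rw [hS]
    ext p
    simp only [Set.mem_ofPred_eq]
    constructor
    · intro h
      have hq := h (!₂[-(1/2), 0])
      have hz : (!₂[-(1/2), 0] : EuclideanSpace ℝ (Fin 2)) 0 + (!₂[-(1/2), 0] : EuclideanSpace ℝ (Fin 2)) 1 = -(1/2) := by
        simp
      simp only [hf, v1 _ hz, v2 _ hz] at hq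
      simp only [hf1, hf2] at hq
      exact aux_eq _ hq
    · intro h q
      simp only [hf, v1 p h, v2 p h]
      simp only [hf1, hf2]
      exact aux_val _
  refine ⟨hSe, ?_, ?_, ?_, ?_⟩
  · intro p hp
    rw [hSe] at hp
    exact ⟨v1 p hp, v2 p hp⟩
  · rw [hf1']; exact aux_inf 0
  · rw [hf2]; exact aux_inf 1
  · intro α β hα hβ _ p q h0 h1
    have hq : q 0 + q 1 = -(1/2) := by rw [h0, h1]; ring
    have hqS : q ∈ S := by rw [hSe]; exact hq
    refine ⟨hqS, le_antisymm ?_ (Metric.infDist_le_dist_of_mem hqS), ?_, ?_⟩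
    · refine (Metric.le_infDist ⟨q, hqS⟩).2 ?_
      intro r hr
      rw [hSe] at hr
      have hr' : r 1 = -(1/2) - r 0 := by
        have : r 0 + r 1 = -(1/2) := hr
        linarith
      rw [EuclideanSpace.dist_eq, EuclideanSpace.dist_eq]
      apply Real.sqrt_le_sqrt
      simp only [Fin.sum_univ_two, Real.dist_eq, sq_abs, h0, h1, hr']
      nlinarith [sq_nonneg (r 0 - (p 0 - p 1 - 1/2)/2)]
    · rw [v1 q hq, hf1', aux_grad_s7]
      have := aux_ineq (p 0 + p 1 + 0) (1/2) α β (by norm_num) hα hβ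
      have e : (p - q) 0 + (p - q) 1 = p 0 + p 1 + 0 + 1/2 := by
        simp only [PiLp.sub_apply]; linarith
      rw [e]; exact this
    · rw [v2 q hq, hf2, aux_grad_s7]
      have := aux_ineq (p 0 + p 1 + 1) (-(1/2)) α β (by norm_num) hα hβ
      have e : (p - q) 0 + (p - q) 1 = p 0 + p 1 + 1 + -(1/2) := by
        simp only [PiLp.sub_apply]; linarith
      rw [e]; exact this
end

section
/- Example 2 (saddle point): Let f_1(x,y) = 1 − exp(−x² − y²), f_2(x,y) = 1 − exp(−(x−2)² − (y−2)²), and f = (f_1 + f_2)/2 on ℝ². Then the set 𝒮 of global minimizers of f is nonempty, every point of 𝒮 has the form (t,t) with 0 < t < 2, inf f_1 = inf f_2 = 0, and there exist parameters α > β > 0 with α − β = 8 such that for every (x,y) ∈ ℝ² and every nearest point (z,t) of (x,y) in 𝒮, for i = 1, 2: ⟨∇f_i(x,y), (x−z, y−t)⟩ ≥ α(f_i(x,y) − f_i(z,t)) − β·f_i(x,y). In particular, f satisfies the α-β-condition on ℝ² with some α and β = α − 8, even though f has a saddle point. -/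
open scoped RealInnerProductSpace BigOperators

lemma aux_inner (a : ℝ) (p v : EuclideanSpace ℝ (Fin 2)) :
    ⟪gradient (fun p : EuclideanSpace ℝ (Fin 2) =>
      1 - Real.exp (-(p 0 - a) ^ 2 - (p 1 - a) ^ 2)) p, v⟫ =
    2 * Real.exp (-(p 0 - a) ^ 2 - (p 1 - a) ^ 2) * ((p 0 - a) * v 0 + (p 1 - a) * v 1) := by
  have h0 : HasFDerivAt (fun p : EuclideanSpace ℝ (Fin 2) => p 0)
      (EuclideanSpace.proj (𝕜 := ℝ) (0 : Fin 2)) p :=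
    (EuclideanSpace.proj (𝕜 := ℝ) (0 : Fin 2)).hasFDerivAt
  have h1 : HasFDerivAt (fun p : EuclideanSpace ℝ (Fin 2) => p 1)
      (EuclideanSpace.proj (𝕜 := ℝ) (1 : Fin 2)) p :=
    (EuclideanSpace.proj (𝕜 := ℝ) (1 : Fin 2)).hasFDerivAt
  have h := ((((h0.sub_const a).pow 2).neg.sub ((h1.sub_const a).pow 2)).exp).const_sub 1
  unfold gradient
  rw [InnerProductSpace.toDual_symm_apply]
  erw [h.fderiv]
  simp
  ring

lemma aux_bound (a t : ℝ) (ha : 0 ≤ a) (ha2 : a ≤ 2) (ht : 0 < t) (ht2 : t < 2)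
    (p q : EuclideanSpace ℝ (Fin 2)) (h0 : q 0 = t) (h1 : q 1 = t) :
    -4 ≤ 2 * Real.exp (-(p 0 - a) ^ 2 - (p 1 - a) ^ 2) *
      ((p 0 - a) * (p - q) 0 + (p 1 - a) * (p - q) 1) := by
  have hE : 0 < Real.exp (-(p 0 - a) ^ 2 - (p 1 - a) ^ 2) := Real.exp_pos _
  have hE1 : Real.exp (-(p 0 - a) ^ 2 - (p 1 - a) ^ 2) ≤ 1 :=
    Real.exp_le_one_iff.2 (by nlinarith [sq_nonneg (p 0 - a), sq_nonneg (p 1 - a)])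
  generalize Real.exp (-(p 0 - a) ^ 2 - (p 1 - a) ^ 2) = E at *
  have h2 : -2 ≤ ((p 0 - a) * (p - q) 0 + (p 1 - a) * (p - q) 1) := by
    simp only [PiLp.sub_apply, h0, h1]
    have : (t - a) ^ 2 ≤ 4 := by nlinarith
    nlinarith [sq_nonneg (p 0 - a - (t - a) / 2), sq_nonneg (p 1 - a - (t - a) / 2)]
  nlinarith

lemma aux_u0 : ∃ r : ℝ, 0 ≤ r ∧ r ≤ 2 ∧
    1 + Real.exp (-8) < Real.exp (-2 * r ^ 2) + Real.exp (-2 * (r - 2) ^ 2) := by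
  have hE := Real.exp_pos (-8)
  have hE1 : Real.exp (-8) ≤ 1 := Real.exp_le_one_iff.2 (by norm_num)
  set E := Real.exp (-8) with hEdef
  refine ⟨E, hE.le, by linarith, ?_⟩
  have e1 := Real.add_one_le_exp (-2 * E ^ 2)
  have e2 := Real.add_one_le_exp (8 * E - 2 * E ^ 2)
  have e3 : Real.exp (-2 * (E - 2) ^ 2) = E * Real.exp (8 * E - 2 * E ^ 2) := by
    rw [hEdef, ← Real.exp_add, ← hEdef]; congr 1; ring
  rw [e3]
  nlinarith [mul_le_mul_of_nonneg_left e2 hE.le, mul_pos hE hE, mul_pos hE (mul_pos hE hE)]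

lemma aux_out (s : ℝ) (h : s ≤ 0 ∨ 2 ≤ s) :
    Real.exp (-2 * s ^ 2) + Real.exp (-2 * (s - 2) ^ 2) ≤ 1 + Real.exp (-8) := by
  rcases h with h | h
  · have a1 : Real.exp (-2 * s ^ 2) ≤ 1 := Real.exp_le_one_iff.2 (by nlinarith)
    have a2 : Real.exp (-2 * (s - 2) ^ 2) ≤ Real.exp (-8) := Real.exp_le_exp.2 (by nlinarith)
    linarith
  · have a1 : Real.exp (-2 * (s - 2) ^ 2) ≤ 1 :=
      Real.exp_le_one_iff.2 (by nlinarith [sq_nonneg (s - 2)])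
    have a2 : Real.exp (-2 * s ^ 2) ≤ Real.exp (-8) := Real.exp_le_exp.2 (by nlinarith)
    linarith

lemma aux_g (x y : ℝ) :
    Real.exp (-x ^ 2 - y ^ 2) + Real.exp (-(x - 2) ^ 2 - (y - 2) ^ 2) =
    Real.exp (-(x - y) ^ 2 / 2) * (Real.exp (-2 * ((x + y) / 2) ^ 2) +
      Real.exp (-2 * ((x + y) / 2 - 2) ^ 2)) := by
  rw [mul_add, ← Real.exp_add, ← Real.exp_add]
  congr 2 <;> ring

/-- Example 2: a function with a saddle point satisfying the α-β-condition with β = α − 8. -/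
theorem example_two_abc
    (f1 f2 f : EuclideanSpace ℝ (Fin 2) → ℝ)
    (hf1 : f1 = fun p => 1 - Real.exp (-(p 0) ^ 2 - (p 1) ^ 2))
    (hf2 : f2 = fun p => 1 - Real.exp (-(p 0 - 2) ^ 2 - (p 1 - 2) ^ 2))
    (hf : f = fun p => (f1 p + f2 p) / 2)
    (S : Set (EuclideanSpace ℝ (Fin 2)))
    (hS : S = {p | ∀ q, f p ≤ f q}) :
    S.Nonempty ∧
    (∀ q ∈ S, ∃ t : ℝ, 0 < t ∧ t < 2 ∧ q 0 = t ∧ q 1 = t) ∧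
    (⨅ p, f1 p) = 0 ∧ (⨅ p, f2 p) = 0 ∧
    (∃ α β : ℝ, 0 < β ∧ β < α ∧ α - β = 8 ∧
      ∀ p : EuclideanSpace ℝ (Fin 2), ∀ q ∈ S, dist p q = Metric.infDist p S →
        (α * (f1 p - f1 q) - β * f1 p ≤ ⟪gradient f1 p, p - q⟫ ∧
         α * (f2 p - f2 q) - β * f2 p ≤ ⟪gradient f2 p, p - q⟫)) := by
  have c1 : Continuous f1 := by rw [hf1]; fun_prop
  have c2 : Continuous f2 := by rw [hf2]; fun_prop
  have c : Continuous f := by rw [hf]; fun_prop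
  have n1 : ∀ p, 0 ≤ f1 p := by
    intro p
    have : Real.exp (-(p 0) ^ 2 - (p 1) ^ 2) ≤ 1 :=
      Real.exp_le_one_iff.2 (by nlinarith [sq_nonneg (p 0), sq_nonneg (p 1)])
    rw [hf1]; simp only; linarith
  have n2 : ∀ p, 0 ≤ f2 p := by
    intro p
    have : Real.exp (-(p 0 - 2) ^ 2 - (p 1 - 2) ^ 2) ≤ 1 :=
      Real.exp_le_one_iff.2 (by nlinarith [sq_nonneg (p 0 - 2), sq_nonneg (p 1 - 2)])
    rw [hf2]; simp only; linarith
  obtain ⟨u, hu⟩ : ∃ u : ℝ → ℝ, u = fun s =>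
    Real.exp (-2 * s ^ 2) + Real.exp (-2 * (s - 2) ^ 2) := ⟨_, rfl⟩
  have upos : ∀ s, 0 < u s := by intro s; rw [hu]; positivity
  have uc : Continuous u := by rw [hu]; fun_prop
  have hfu : ∀ p, f p = 1 - Real.exp (-(p 0 - p 1) ^ 2 / 2) * u ((p 0 + p 1) / 2) / 2 := by
    intro p
    have := aux_g (p 0) (p 1)
    rw [hu, hf, hf1, hf2]; simp only
    rw [← this]; ring
  have hfd : ∀ s : ℝ, f !₂[s, s] = 1 - u s / 2 := by
    intro s
    rw [hfu]; simp
  have hne : S.Nonempty := by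
    obtain ⟨t, ht, hmax⟩ := isCompact_Icc.exists_isMaxOn (s := Set.Icc (0:ℝ) 2)
      ⟨0, by norm_num⟩ uc.continuousOn
    have hall : ∀ s, u s ≤ u t := by
      intro s
      by_cases hs : s ∈ Set.Icc (0:ℝ) 2
      · exact hmax hs
      · have h0 : u 0 ≤ u t := hmax (by norm_num : (0:ℝ) ∈ Set.Icc (0:ℝ) 2)
        have h1 : u s ≤ 1 + Real.exp (-8) := by
          rw [hu]; apply aux_out
          by_contra! hc
          exact hs ⟨hc.1.le, hc.2.le⟩
        have h2 : u 0 = 1 + Real.exp (-8) := by rw [hu]; norm_num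
        linarith
    refine ⟨!₂[t, t], ?_⟩
    rw [hS]
    intro q
    rw [hfd, hfu]
    have : Real.exp (-(q 0 - q 1) ^ 2 / 2) ≤ 1 :=
      Real.exp_le_one_iff.2 (by nlinarith [sq_nonneg (q 0 - q 1)])
    nlinarith [hall ((q 0 + q 1) / 2), upos ((q 0 + q 1) / 2)]
  have hdiag : ∀ q ∈ S, ∃ t : ℝ, 0 < t ∧ t < 2 ∧ q 0 = t ∧ q 1 = t := by
    intro q hq
    rw [hS] at hq
    have hxy : q 0 = q 1 := by
      by_contra hne
      have h := hq !₂[(q 0 + q 1) / 2, (q 0 + q 1) / 2]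
      rw [hfd, hfu] at h
      have h3 : 0 < (q 0 - q 1) ^ 2 := by have := sub_ne_zero.2 hne; positivity
      have : Real.exp (-(q 0 - q 1) ^ 2 / 2) < 1 := Real.exp_lt_one_iff.2 (by linarith)
      nlinarith [upos ((q 0 + q 1) / 2)]
    obtain ⟨r, -, -, hr⟩ := aux_u0
    have h := hq !₂[r, r]
    have e : (q 1 + q 1) / 2 = q 1 := by ring
    rw [hfd, hfu, hxy, e] at h
    simp only [sub_self, ne_eq, OfNat.ofNat_ne_zero, not_false_eq_true, zero_pow, neg_zero,
      zero_div, Real.exp_zero, one_mul] at h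
    have hlt : 1 + Real.exp (-8) < u (q 1) := by
      have : u r = Real.exp (-2 * r ^ 2) + Real.exp (-2 * (r - 2) ^ 2) := by rw [hu]
      linarith
    have hin : ¬ (q 1 ≤ 0 ∨ 2 ≤ q 1) := by
      intro hc
      have := aux_out _ hc
      rw [hu] at hlt
      simp only at hlt
      linarith
    push Not at hin
    exact ⟨q 1, hin.1, hin.2, hxy, rfl⟩
  have hcl : IsClosed S := by
    have : S = ⋂ q, {p | f p ≤ f q} := by rw [hS]; ext; simp
    rw [this]
    exact isClosed_iInter fun q => isClosed_le c continuous_const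
  have hbd : Bornology.IsBounded S := by
    refine (Metric.isBounded_closedBall (x := 0) (r := 4)).subset ?_
    intro q hq
    obtain ⟨t, h1, h2, h3, h4⟩ := hdiag q hq
    rw [mem_closedBall_zero_iff, EuclideanSpace.norm_eq, Real.sqrt_le_left (by norm_num)]
    simp [Fin.sum_univ_two, h3, h4]
    nlinarith
  have hcpt : IsCompact S := Metric.isCompact_of_isClosed_isBounded hcl hbd
  refine ⟨hne, hdiag, ?_, ?_, ?_⟩
  · apply le_antisymm
    · have := ciInf_le ⟨0, by rintro _ ⟨p, rfl⟩; exact n1 p⟩ (0 : EuclideanSpace ℝ (Fin 2)) (f := f1)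
      refine this.trans (le_of_eq ?_)
      rw [hf1]; simp
    · exact le_ciInf n1
  · apply le_antisymm
    · have := ciInf_le ⟨0, by rintro _ ⟨p, rfl⟩; exact n2 p⟩ (!₂[2, 2] : EuclideanSpace ℝ (Fin 2))
        (f := f2)
      refine this.trans (le_of_eq ?_)
      rw [hf2]; simp
    · exact le_ciInf n2
  · obtain ⟨q1, hq1, hm1⟩ := hcpt.exists_isMinOn hne c1.continuousOn
    obtain ⟨q2, hq2, hm2⟩ := hcpt.exists_isMinOn hne c2.continuousOn
    have p1 : 0 < f1 q1 := by
      obtain ⟨t, h1, h2, h3, h4⟩ := hdiag q1 hq1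
      have : Real.exp (-(q1 0) ^ 2 - (q1 1) ^ 2) < 1 :=
        Real.exp_lt_one_iff.2 (by rw [h3, h4]; nlinarith)
      rw [hf1]; simp only; linarith
    have p2 : 0 < f2 q2 := by
      obtain ⟨t, h1, h2, h3, h4⟩ := hdiag q2 hq2
      have : Real.exp (-(q2 0 - 2) ^ 2 - (q2 1 - 2) ^ 2) < 1 :=
        Real.exp_lt_one_iff.2 (by rw [h3, h4]; nlinarith)
      rw [hf2]; simp only; linarith
    obtain ⟨m, hm, hma, hmb⟩ : ∃ m, 0 < m ∧ m ≤ f1 q1 ∧ m ≤ f2 q2 :=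
      ⟨min (f1 q1) (f2 q2), lt_min p1 p2, min_le_left _ _, min_le_right _ _⟩
    have hdiv : 12 / m * m = 12 := by field_simp
    have hdp : 0 < 12 / m := by positivity
    refine ⟨12 / m + 9, 12 / m + 1, by linarith, by linarith, by ring, ?_⟩
    intro p q hq _
    obtain ⟨t, h1, h2, h3, h4⟩ := hdiag q hq
    have k1 : m ≤ f1 q := hma.trans (hm1 hq)
    have k2 : m ≤ f2 q := hmb.trans (hm2 hq)
    have l1 : f1 p ≤ 1 := by rw [hf1]; simp only; linarith [Real.exp_pos (-(p 0) ^ 2 - (p 1) ^ 2)]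
    have l2 : f2 p ≤ 1 := by
      rw [hf2]; simp only; linarith [Real.exp_pos (-(p 0 - 2) ^ 2 - (p 1 - 2) ^ 2)]
    have g1 : -4 ≤ ⟪gradient f1 p, p - q⟫ := by
      have e : f1 = fun p => 1 - Real.exp (-(p 0 - 0) ^ 2 - (p 1 - 0) ^ 2) := by
        rw [hf1]; simp only [sub_zero]
      rw [e, aux_inner]
      exact aux_bound 0 t le_rfl (by norm_num) h1 h2 p q h3 h4
    have g2 : -4 ≤ ⟪gradient f2 p, p - q⟫ := by
      rw [hf2, aux_inner]
      exact aux_bound 2 t (by norm_num) le_rfl h1 h2 p q h3 h4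
    have d1 := mul_le_mul_of_nonneg_left k1 hdp.le
    have d2 := mul_le_mul_of_nonneg_left k2 hdp.le
    constructor
    · nlinarith
    · nlinarith
end

section
/- Example 7, positive part: Let f_1(x,y) = (x² + y²)/(1 + x² + y²), f_2(x,y) = ((x−1)² + (y−1)²)/(1 + (x−1)² + (y−1)²), and f = (f_1 + f_2)/2 on ℝ². Then inf f_1 = inf f_2 = 0, the set 𝒮 of global minimizers of f is nonempty, c := min_{i∈{1,2}} inf_{(z,t)∈𝒮} f_i(z,t) > 0, and there exists α_0 ≥ 1 such that for every α ≥ α_0, setting β = α − 1, for every (x,y) ∈ ℝ² and every nearest point (z,t) of (x,y) in 𝒮, for i = 1, 2: ⟨∇f_i(x,y), (x−z, y−t)⟩ ≥ α(f_i(x,y) − f_i(z,t)) − β·f_i(x,y). In particular, f satisfies the α-β-condition on ℝ² with any α ≥ 2/c and β = α − 1. -/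
open scoped RealInnerProductSpace BigOperators

namespace ExSeven

/-- The shifted loss. -/
noncomputable def G (a : ℝ) (p : EuclideanSpace ℝ (Fin 2)) : ℝ :=
  ((p 0 - a) ^ 2 + (p 1 - a) ^ 2) / (1 + (p 0 - a) ^ 2 + (p 1 - a) ^ 2)

lemma den_pos (a : ℝ) (p : EuclideanSpace ℝ (Fin 2)) :
    0 < 1 + (p 0 - a) ^ 2 + (p 1 - a) ^ 2 := by positivity

lemma G_nonneg (a : ℝ) (p : EuclideanSpace ℝ (Fin 2)) : 0 ≤ G a p := by
  unfold G; positivity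

lemma G_diff (a : ℝ) : Differentiable ℝ (G a) := by
  intro p
  have h := (den_pos a p).ne'
  unfold G
  fun_prop (disch := assumption)

lemma G_grad (a : ℝ) (p v : EuclideanSpace ℝ (Fin 2)) :
    ⟪gradient (G a) p, v⟫ =
      2 * ((p 0 - a) * v 0 + (p 1 - a) * v 1) / (1 + (p 0 - a) ^ 2 + (p 1 - a) ^ 2) ^ 2 := by
  have h1 : ⟪gradient (G a) p, v⟫ = fderiv ℝ (G a) p v := by
    simp [gradient]
  have h2 := ((G_diff a p).hasFDerivAt.hasLineDerivAt v)
  have hd := (den_pos a p).ne'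
  have h3 : HasLineDerivAt ℝ (G a)
      (2 * ((p 0 - a) * v 0 + (p 1 - a) * v 1) / (1 + (p 0 - a) ^ 2 + (p 1 - a) ^ 2) ^ 2) p v := by
    unfold HasLineDerivAt
    have e : ∀ i, HasDerivAt (fun t : ℝ => (p i + t * v i - a) ^ 2) (2 * (p i - a) * v i) 0 := by
      intro i
      have := ((((hasDerivAt_id (0:ℝ)).mul_const (v i)).const_add (p i)).sub_const a).pow 2
      exact this.congr_deriv (by simp)
    have en := (e 0).add (e 1)
    have ed := ((e 0).const_add 1).add (e 1)
    have := en.div ed (by simpa using hd)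
    refine HasDerivAt.congr_deriv (f := fun t : ℝ => G a (p + t • v)) this ?_
    simp only [Pi.add_apply, zero_mul, add_zero]
    congr 1
    ring
  rw [h1]
  exact HasDerivAt.unique h2 h3

lemma key (a α : ℝ) (p q : EuclideanSpace ℝ (Fin 2))
    (hq : (q 0 - a) ^ 2 + (q 1 - a) ^ 2 ≤ 2) (hα : 2 ≤ α * G a q) :
    α * (G a p - G a q) - (α - 1) * G a p ≤ ⟪gradient (G a) p, p - q⟫ := by
  rw [G_grad]
  have hd := den_pos a p
  have : G a p - 2 ≤ 2 * ((p 0 - a) * (p - q) 0 + (p 1 - a) * (p - q) 1) /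
      (1 + (p 0 - a) ^ 2 + (p 1 - a) ^ 2) ^ 2 := by
    unfold G
    rw [div_sub' hd.ne', div_le_div_iff₀ hd (by positivity)]
    simp only [PiLp.sub_apply]
    have e0 : p 0 - q 0 = (p 0 - a) - (q 0 - a) := by ring
    have e1 : p 1 - q 1 = (p 1 - a) - (q 1 - a) := by ring
    rw [e0, e1]
    generalize p 0 - a = x at *
    generalize p 1 - a = y at *
    generalize q 0 - a = z at *
    generalize q 1 - a = t at *
    have : (x ^ 2 + y ^ 2 - (1 + x ^ 2 + y ^ 2) * 2) * (1 + x ^ 2 + y ^ 2) ≤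
        2 * (x * (x - z) + y * (y - t)) := by
      nlinarith [sq_nonneg (x - z), sq_nonneg (y - t), sq_nonneg (x^2+y^2), sq_nonneg x, sq_nonneg y]
    nlinarith [mul_le_mul_of_nonneg_right this hd.le]
  linarith

lemma G_iInf (a : ℝ) : (⨅ p, G a p) = 0 := by
  apply le_antisymm
  · have : G a (!₂[a, a]) = 0 := by simp [G]
    rw [← this]
    exact ciInf_le ⟨0, by rintro _ ⟨p, rfl⟩; exact G_nonneg a p⟩ _
  · exact le_ciInf (G_nonneg a)

lemma sq_le_of_G_le (a : ℝ) (q : EuclideanSpace ℝ (Fin 2)) (h : G a q ≤ 2 / 3) :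
    (q 0 - a) ^ 2 + (q 1 - a) ^ 2 ≤ 2 := by
  unfold G at h
  rw [div_le_div_iff₀ (den_pos a q) (by norm_num)] at h
  linarith

lemma G_pos (a : ℝ) (q : EuclideanSpace ℝ (Fin 2)) (h : q ≠ !₂[a, a]) : 0 < G a q := by
  rcases (G_nonneg a q).lt_or_eq with h1 | h1
  · exact h1
  exfalso
  apply h
  unfold G at h1
  have := (div_eq_zero_iff.1 h1.symm).resolve_right (den_pos a q).ne'
  have h0 : q 0 - a = 0 := by nlinarith [sq_nonneg (q 0 - a), sq_nonneg (q 1 - a)]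
  have h2 : q 1 - a = 0 := by nlinarith [sq_nonneg (q 0 - a), sq_nonneg (q 1 - a)]
  ext i
  fin_cases i
  · simpa using sub_eq_zero.1 h0
  · simpa using sub_eq_zero.1 h2

/-- Minimizers. -/
def T : Set (EuclideanSpace ℝ (Fin 2)) :=
  {p | ∀ q, (G 0 p + G 1 p) / 2 ≤ (G 0 q + G 1 q) / 2}

lemma T_le {q : EuclideanSpace ℝ (Fin 2)} (hq : q ∈ T) : G 0 q ≤ 2 / 3 ∧ G 1 q ≤ 2 / 3 := by
  have h := hq 0
  have e0 : G 0 0 = 0 := by simp [G]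
  have e1 : G 1 0 = 2 / 3 := by norm_num [G]
  rw [e0, e1] at h
  constructor <;> linarith [G_nonneg 0 q, G_nonneg 1 q]

lemma T_pos {q : EuclideanSpace ℝ (Fin 2)} (hq : q ∈ T) : 0 < G 0 q ∧ 0 < G 1 q := by
  have h := hq (!₂[1 / 10, 1 / 10])
  constructor
  · apply G_pos
    rintro rfl
    norm_num [G] at h
  · apply G_pos
    rintro rfl
    norm_num [G] at h

lemma mem_ball {q : EuclideanSpace ℝ (Fin 2)} (h : G 0 q ≤ 2 / 3) :
    q ∈ Metric.closedBall (0 : EuclideanSpace ℝ (Fin 2)) 2 := by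
  have := sq_le_of_G_le 0 q h
  rw [mem_closedBall_zero_iff, EuclideanSpace.norm_eq, Real.sqrt_le_left (by norm_num)]
  simp [Fin.sum_univ_two] at *
  linarith

lemma T_closed : IsClosed T := by
  have c0 := (G_diff 0).continuous
  have c1 := (G_diff 1).continuous
  have : T = ⋂ q, {p | (G 0 p + G 1 p) / 2 ≤ (G 0 q + G 1 q) / 2} := by
    ext; simp [T]
  rw [this]
  exact isClosed_iInter fun q => isClosed_le (by fun_prop) continuous_const

lemma T_compact : IsCompact T :=
  (isCompact_closedBall _ _).of_isClosed_subset T_closed fun _ hq => mem_ball (T_le hq).1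

lemma T_nonempty : T.Nonempty := by
  have c0 := (G_diff 0).continuous
  have c1 := (G_diff 1).continuous
  obtain ⟨m, _, hm⟩ := (isCompact_closedBall (0 : EuclideanSpace ℝ (Fin 2)) 2).exists_isMinOn
    ⟨0, by simp⟩ (f := fun p => (G 0 p + G 1 p) / 2) (by fun_prop)
  refine ⟨m, fun q => ?_⟩
  by_cases hq : G 0 q ≤ 2 / 3
  · exact hm (mem_ball hq)
  · have h : (G 0 m + G 1 m) / 2 ≤ (G 0 0 + G 1 0) / 2 := hm (by simp)
    have e0 : G 0 0 = 0 := by simp [G]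
    have e1 : G 1 0 = 2 / 3 := by norm_num [G]
    rw [e0, e1] at h
    linarith [G_nonneg 1 q]

lemma sInf_pos (a : ℝ) (h : ∀ q ∈ T, 0 < G a q) : 0 < sInf (G a '' T) := by
  have := (T_compact.image (G_diff a).continuous).sInf_mem (T_nonempty.image _)
  obtain ⟨q, hq, e⟩ := this
  rw [← e]
  exact h q hq

lemma sInf_le' (a : ℝ) {q : EuclideanSpace ℝ (Fin 2)} (h : q ∈ T) : sInf (G a '' T) ≤ G a q :=
  csInf_le ⟨0, by rintro _ ⟨p, _, rfl⟩; exact G_nonneg a p⟩ ⟨q, h, rfl⟩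

end ExSeven



/-- Example 7, positive part: the α-β-condition holds with β = α − 1 for
all α ≥ 2/c, where c is the smallest value of the individual losses on 𝒮. -/
theorem example_seven_positive_abc
    (f1 f2 f : EuclideanSpace ℝ (Fin 2) → ℝ)
    (hf1 : f1 = fun p => ((p 0) ^ 2 + (p 1) ^ 2) / (1 + (p 0) ^ 2 + (p 1) ^ 2))
    (hf2 : f2 = fun p =>
      ((p 0 - 1) ^ 2 + (p 1 - 1) ^ 2) / (1 + (p 0 - 1) ^ 2 + (p 1 - 1) ^ 2))
    (hf : f = fun p => (f1 p + f2 p) / 2)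
    (S : Set (EuclideanSpace ℝ (Fin 2)))
    (hS : S = {p | ∀ q, f p ≤ f q}) :
    (⨅ p, f1 p) = 0 ∧ (⨅ p, f2 p) = 0 ∧
    S.Nonempty ∧
    (∀ c : ℝ, c = min (sInf (f1 '' S)) (sInf (f2 '' S)) →
      0 < c ∧
      (∃ α0 : ℝ, 1 ≤ α0 ∧ ∀ α : ℝ, α0 ≤ α →
        ∀ p : EuclideanSpace ℝ (Fin 2), ∀ q ∈ S, dist p q = Metric.infDist p S →
          (α * (f1 p - f1 q) - (α - 1) * f1 p ≤ ⟪gradient f1 p, p - q⟫ ∧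
           α * (f2 p - f2 q) - (α - 1) * f2 p ≤ ⟪gradient f2 p, p - q⟫)) ∧
      (∀ α : ℝ, 2 / c ≤ α →
        ∀ p : EuclideanSpace ℝ (Fin 2), ∀ q ∈ S, dist p q = Metric.infDist p S →
          (α * (f1 p - f1 q) - (α - 1) * f1 p ≤ ⟪gradient f1 p, p - q⟫ ∧
           α * (f2 p - f2 q) - (α - 1) * f2 p ≤ ⟪gradient f2 p, p - q⟫))) := by
  have e1 : f1 = ExSeven.G 0 := by
    rw [hf1]; funext p; simp [ExSeven.G]
  have e2 : f2 = ExSeven.G 1 := by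
    rw [hf2]; rfl
  have eS : S = ExSeven.T := by
    rw [hS, hf, e1, e2]; rfl
  clear hf1 hf2 hS hf
  subst e1 e2 eS
  refine ⟨ExSeven.G_iInf 0, ExSeven.G_iInf 1, ExSeven.T_nonempty, ?_⟩
  intro c hc
  have hpos : 0 < c := by
    rw [hc]
    exact lt_min (ExSeven.sInf_pos 0 fun q hq => (ExSeven.T_pos hq).1)
      (ExSeven.sInf_pos 1 fun q hq => (ExSeven.T_pos hq).2)
  have main : ∀ α : ℝ, 2 / c ≤ α →
        ∀ p : EuclideanSpace ℝ (Fin 2), ∀ q ∈ ExSeven.T, dist p q = Metric.infDist p ExSeven.T →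
          (α * (ExSeven.G 0 p - ExSeven.G 0 q) - (α - 1) * ExSeven.G 0 p
              ≤ ⟪gradient (ExSeven.G 0) p, p - q⟫ ∧
           α * (ExSeven.G 1 p - ExSeven.G 1 q) - (α - 1) * ExSeven.G 1 p
              ≤ ⟪gradient (ExSeven.G 1) p, p - q⟫) := by
    intro α hα p q hq _
    have h2 : 2 ≤ α * c := (div_le_iff₀ hpos).1 hα
    have hα0 : 0 ≤ α := le_trans (by positivity) hα
    have c0 : c ≤ ExSeven.G 0 q := by
      rw [hc]; exact (min_le_left _ _).trans (ExSeven.sInf_le' 0 hq)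
    have c1 : c ≤ ExSeven.G 1 q := by
      rw [hc]; exact (min_le_right _ _).trans (ExSeven.sInf_le' 1 hq)
    exact ⟨ExSeven.key 0 α p q (ExSeven.sq_le_of_G_le 0 q (ExSeven.T_le hq).1)
        (h2.trans (mul_le_mul_of_nonneg_left c0 hα0)),
      ExSeven.key 1 α p q (ExSeven.sq_le_of_G_le 1 q (ExSeven.T_le hq).2)
        (h2.trans (mul_le_mul_of_nonneg_left c1 hα0))⟩
  exact ⟨hpos, ⟨max 1 (2 / c), le_max_left _ _,
    fun α h => main α ((le_max_right _ _).trans h)⟩, main⟩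
end

section
/- Example 7, negative part (failure with β = 0): Let f_1(x,y) = (x² + y²)/(1 + x² + y²), f_2(x,y) = ((x−1)² + (y−1)²)/(1 + (x−1)² + (y−1)²), and f = (f_1 + f_2)/2 on ℝ², with 𝒮 = argmin f nonempty. Then for every α > 0 there exists (x,y) ∈ ℝ² such that for every nearest point (z,t) of (x,y) in 𝒮 there exists i ∈ {1,2} with ⟨∇f_i(x,y), (x−z, y−t)⟩ < α(f_i(x,y) − f_i(z,t)). That is, f does not satisfy the α-β-condition on ℝ² with β = 0 for any α > 0. -/
open scoped RealInnerProductSpace BigOperators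

/-- Example 7, negative part: the α-β-condition with β = 0 fails for every α > 0. -/
theorem example_seven_negative_abc
    (f1 f2 f : EuclideanSpace ℝ (Fin 2) → ℝ)
    (hf1 : f1 = fun p => ((p 0) ^ 2 + (p 1) ^ 2) / (1 + (p 0) ^ 2 + (p 1) ^ 2))
    (hf2 : f2 = fun p =>
      ((p 0 - 1) ^ 2 + (p 1 - 1) ^ 2) / (1 + (p 0 - 1) ^ 2 + (p 1 - 1) ^ 2))
    (hf : f = fun p => (f1 p + f2 p) / 2)
    (S : Set (EuclideanSpace ℝ (Fin 2)))
    (hS : S = {p | ∀ q, f p ≤ f q}) (hSne : S.Nonempty) :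
    ∀ α : ℝ, 0 < α →
      ∃ p : EuclideanSpace ℝ (Fin 2), ∀ q ∈ S, dist p q = Metric.infDist p S →
        (⟪gradient f1 p, p - q⟫ < α * (f1 p - f1 q) ∨
         ⟪gradient f2 p, p - q⟫ < α * (f2 p - f2 q)) := by
  intro α hα
  set t : ℝ := 2 + 12 / α with ht
  have h12 : 0 < 12 / α := by positivity
  have ht2 : 2 < t := by linarith
  have hαt : α * t = 2 * α + 12 := by rw [ht]; field_simp
  refine ⟨!₂[t, 0], fun q hq _ => Or.inl ?_⟩
  set p : EuclideanSpace ℝ (Fin 2) := !₂[t, 0] with hp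
  have hp0 : p 0 = t := by simp [hp]
  have hp1 : p 1 = 0 := by simp [hp]
  have hqm : f q ≤ f 0 := by rw [hS] at hq; exact hq 0
  have hf2q : 0 ≤ f2 q := by rw [hf2]; positivity
  have hf0 : f 0 = 1 / 3 := by rw [hf, hf1, hf2]; norm_num
  have hfq : f q = (f1 q + f2 q) / 2 := by rw [hf]
  have hf1q : f1 q ≤ 2 / 3 := by linarith
  have hq2 : (q 0) ^ 2 + (q 1) ^ 2 ≤ 2 := by
    have h := hf1q
    rw [hf1] at h
    simp only at h
    rw [div_le_div_iff₀ (by positivity) (by norm_num)] at h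
    linarith
  have hq0 : -2 ≤ q 0 := by nlinarith [sq_nonneg (q 1)]
  have hf1p : f1 p = t ^ 2 / (1 + t ^ 2) := by rw [hf1]; simp [hp0, hp1]
  have hinner : ⟪gradient f1 p, p - q⟫ = 2 * t * (t - q 0) / (1 + t ^ 2) ^ 2 := by
    have hd0 : HasFDerivAt (fun x : EuclideanSpace ℝ (Fin 2) => x 0)
        (EuclideanSpace.proj 0 : EuclideanSpace ℝ (Fin 2) →L[ℝ] ℝ) p :=
      (EuclideanSpace.proj 0 : EuclideanSpace ℝ (Fin 2) →L[ℝ] ℝ).hasFDerivAt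
    have hd1 : HasFDerivAt (fun x : EuclideanSpace ℝ (Fin 2) => x 1)
        (EuclideanSpace.proj 1 : EuclideanSpace ℝ (Fin 2) →L[ℝ] ℝ) p :=
      (EuclideanSpace.proj 1 : EuclideanSpace ℝ (Fin 2) →L[ℝ] ℝ).hasFDerivAt
    have hn := (hd0.pow 2).add (hd1.pow 2)
    have hg : HasDerivAt (fun r : ℝ => r / (1 + r)) (1 / (1 + t ^ 2) ^ 2) (t ^ 2) := by
      have h := (hasDerivAt_id (t ^ 2)).div ((hasDerivAt_id (t ^ 2)).const_add 1)
        (by simp only [id]; positivity)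
      have h' := h.congr_deriv (g' := 1 / (1 + t ^ 2) ^ 2) (by simp)
      exact h'
    have hD := HasDerivAt.comp_hasFDerivAt_of_eq (𝕜 := ℝ) (𝕜' := ℝ) p hg hn (by simp [hp0, hp1])
    have hfe : f1 = (fun r : ℝ => r / (1 + r)) ∘
        ((fun x : EuclideanSpace ℝ (Fin 2) => x 0 ^ 2) +
          (fun x : EuclideanSpace ℝ (Fin 2) => x 1 ^ 2)) := by
      rw [hf1]
      funext x
      simp [add_assoc]
    rw [← hfe] at hD
    rw [gradient, InnerProductSpace.toDual_symm_apply, hD.fderiv]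
    simp [hp0, hp1]
    field_simp
  rw [hinner, hf1p]
  have h1 : 2 * t * (t - q 0) / (1 + t ^ 2) ^ 2 ≤ 4 / (1 + t ^ 2) := by
    rw [div_le_div_iff₀ (by positivity) (by positivity)]
    have : 2 * t * (t - q 0) ≤ 4 * (1 + t ^ 2) := by nlinarith
    have h3 : 0 < 1 + t ^ 2 := by positivity
    nlinarith
  have h2 : 4 / (1 + t ^ 2) < α * (t ^ 2 / (1 + t ^ 2) - 2 / 3) := by
    have h3 : 0 < 1 + t ^ 2 := by positivity
    have : α * (t ^ 2 / (1 + t ^ 2) - 2 / 3) = (α * (t ^ 2 - 2) / 3) / (1 + t ^ 2) := by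
      field_simp; ring
    rw [this]
    apply div_lt_div_of_pos_right _ h3
    nlinarith
  have h4 : α * (t ^ 2 / (1 + t ^ 2) - 2 / 3) ≤ α * (t ^ 2 / (1 + t ^ 2) - f1 q) := by
    apply mul_le_mul_of_nonneg_left _ hα.le
    linarith
  linarith
end
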